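/- arXiv:math/0605541 — 8 statements merged into one kernel-verified Lean document; each statement's English description precedes it below -/
import Mathlib

section
/- Let (C,≤) be a pospace. Any retract of a dihomotopy equivalence relative to (C,≤) is a dihomotopy equivalence relative to (C,≤): if a (C,≤)-dimap f : X → Y is a retract of a (C,≤)-dimap f' : X' → Y' and f' is a dihomotopy equivalence relative to (C,≤), then f is a dihomotopy equivalence relative to (C,≤). -/
universe u

/-- A dimap between pospaces: a continuous monotone map. -/
def IsDimap {X Y : Type*} [TopologicalSpace X] [PartialOrder X]
    [TopologicalSpace Y] [PartialOrder Y] (f : X → Y) : Prop :=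
  Continuous f ∧ Monotone f

/-- A `(C,≤)`-dimap between `(C,≤)`-pospaces `(X,≤,ξ)` and `(Y,≤,θ)`. -/
def IsCDimap {C X Y : Type*} [TopologicalSpace X] [PartialOrder X]
    [TopologicalSpace Y] [PartialOrder Y] (ξ : C → X) (θ : C → Y) (f : X → Y) : Prop :=
  Continuous f ∧ Monotone f ∧ ∀ c, f (ξ c) = θ c

/-- Dihomotopy relative to `(C,≤)` between maps `(X,≤,ξ) → (Y,≤,θ)`. -/
def DihRel {C X Y : Type*} [TopologicalSpace X] [PartialOrder X]
    [TopologicalSpace Y] [PartialOrder Y] (ξ : C → X) (θ : C → Y) (f g : X → Y) : Prop :=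
  ∃ H : X × unitInterval → Y, Continuous H ∧ (∀ t, Monotone fun x => H (x, t)) ∧
    (∀ x, H (x, 0) = f x) ∧ (∀ x, H (x, 1) = g x) ∧ ∀ c t, H (ξ c, t) = θ c

/-- Dihomotopy equivalence relative to `(C,≤)`. -/
def IsDihEquivRel {C X Y : Type*} [TopologicalSpace X] [PartialOrder X]
    [TopologicalSpace Y] [PartialOrder Y] (ξ : C → X) (θ : C → Y) (f : X → Y) : Prop :=
  IsCDimap ξ θ f ∧ ∃ g : Y → X, IsCDimap θ ξ g ∧
    DihRel ξ ξ (g ∘ f) id ∧ DihRel θ θ (f ∘ g) id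

/-- A `(C,≤)`-difibration. -/
def IsDifib {C : Type*} [TopologicalSpace C] [PartialOrder C]
    {E B : Type*} [TopologicalSpace E] [PartialOrder E]
    [TopologicalSpace B] [PartialOrder B]
    (ε : C → E) (β : C → B) (p : E → B) : Prop :=
  IsCDimap ε β p ∧
  ∀ (X : Type u) [TopologicalSpace X] [PartialOrder X] (ξ : C → X), IsDimap ξ →
    ∀ f : X → E, IsCDimap ξ ε f →
      ∀ H : X × unitInterval → B, Continuous H → (∀ t, Monotone fun x => H (x, t)) →
        (∀ x, H (x, 0) = p (f x)) → (∀ c t, H (ξ c, t) = β c) →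
        ∃ G : X × unitInterval → E, Continuous G ∧ (∀ t, Monotone fun x => G (x, t)) ∧
          (∀ x, G (x, 0) = f x) ∧ (∀ x t, p (G (x, t)) = H (x, t)) ∧ ∀ c t, G (ξ c, t) = ε c

section

variable {C X Y Z W : Type*} [TopologicalSpace X] [PartialOrder X] [TopologicalSpace Y]
  [PartialOrder Y] [TopologicalSpace Z] [PartialOrder Z] [TopologicalSpace W] [PartialOrder W]

/-- `(C,≤)`-dimaps are closed under composition. -/
theorem IsCDimap.comp {ξ : C → X} {θ : C → Y} {ζ : C → Z} {g : Y → Z} {f : X → Y}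
    (hg : IsCDimap θ ζ g) (hf : IsCDimap ξ θ f) : IsCDimap ξ ζ (g ∘ f) :=
  ⟨hg.1.comp hf.1, hg.2.1.comp hf.2.1, fun c => by simp [hf.2.2, hg.2.2]⟩

/-- Relative dihomotopy is preserved by composition with `(C,≤)`-dimaps on both sides. -/
theorem DihRel.comp {ξ : C → X} {θ : C → Y} {ζ : C → Z} {ω : C → W} {f g : Y → Z}
    (h : DihRel θ ζ f g) {a : X → Y} {b : Z → W} (ha : IsCDimap ξ θ a) (hb : IsCDimap ζ ω b) :
    DihRel ξ ω (b ∘ f ∘ a) (b ∘ g ∘ a) := by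
  obtain ⟨H, hH, hmono, h0, h1, hrel⟩ := h
  refine ⟨fun p => b (H (a p.1, p.2)), ?_, fun t => hb.2.1.comp ((hmono t).comp ha.2.1),
    fun x => by simp [h0], fun x => by simp [h1], fun c t => by simp [ha.2.2, hrel, hb.2.2]⟩
  exact hb.1.comp (hH.comp ((ha.1.comp continuous_fst).prodMk continuous_snd))

end

/-- A retract of a dihomotopy equivalence relative to `(C,≤)` is a
dihomotopy equivalence relative to `(C,≤)`. -/
theorem dihEquivRel_of_retract {C X Y X' Y' : Type*} [TopologicalSpace C] [PartialOrder C]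
    [TopologicalSpace X] [PartialOrder X] [TopologicalSpace Y] [PartialOrder Y]
    [TopologicalSpace X'] [PartialOrder X'] [TopologicalSpace Y'] [PartialOrder Y']
    (ξ : C → X) (θ : C → Y) (ξ' : C → X') (θ' : C → Y')
    (hξ : IsDimap ξ) (hθ : IsDimap θ) (hξ' : IsDimap ξ') (hθ' : IsDimap θ')
    (f : X → Y) (f' : X' → Y') (hf : IsCDimap ξ θ f) (hf' : IsCDimap ξ' θ' f')
    (i : X → X') (r : X' → X) (j : Y → Y') (s : Y' → Y)
    (hi : IsCDimap ξ ξ' i) (hr : IsCDimap ξ' ξ r) (hj : IsCDimap θ θ' j) (hs : IsCDimap θ' θ s)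
    (hri : r ∘ i = id) (hsj : s ∘ j = id)
    (hsq₁ : f' ∘ i = j ∘ f) (hsq₂ : s ∘ f' = f ∘ r)
    (hf'equiv : IsDihEquivRel ξ' θ' f') :
    IsDihEquivRel ξ θ f := by
  obtain ⟨-, g', hg', hgf, hfg⟩ := hf'equiv
  refine ⟨hf, r ∘ g' ∘ j, hr.comp (hg'.comp hj), ?_, ?_⟩
  · have h := hgf.comp hi hr
    rwa [Function.id_comp, hri, Function.comp_assoc g', hsq₁] at h
  · have h := hfg.comp hj hs
    rwa [Function.id_comp, hsj, Function.comp_assoc f', ← Function.comp_assoc s, hsq₂] at h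
end

section
/- Let (C,≤) be a pospace and let p : (E,≤,ε) → (B,≤,β) be a (C,≤)-difibration. Let W = {(e,e',ω) ∈ E × E × B^I : ω(0) = p(e) and ω(1) = p(e')} carry the subspace topology of the product, the componentwise partial order, and the structure dimap c ↦ (ε(c), ε(c), c_β(c)). Then the (C,≤)-dimap (ev_0, ev_1, p^I) : (E^I,≤,c_ε) → (W,≤), sending a path ω to (ω(0), ω(1), p ∘ ω), is a (C,≤)-difibration. -/
universe u

/-- The product `X × I`, preordered by the relation generated by the order of `X` on each slice
and by collapsing the segments over the image of `ξ`. -/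
def RelCylinder {C X : Type*} (_ : C → X) : Type _ := X × unitInterval

namespace RelCylinder

variable {C X : Type*} [PartialOrder X] {ξ : C → X}

instance : Preorder (RelCylinder ξ) where
  le q q' := q.1 ≤ q'.1 ∧ (q.2 = q'.2 ∨ ∃ c, q.1 ≤ ξ c ∧ ξ c ≤ q'.1)
  le_refl q := ⟨le_rfl, Or.inl rfl⟩
  le_trans := by
    rintro q q' q'' ⟨h, h₂⟩ ⟨h', h₂'⟩
    refine ⟨h.trans h', ?_⟩
    rcases h₂ with h₂ | ⟨c, hc, hc'⟩
    · rcases h₂' with h₂' | ⟨c, hc, hc'⟩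
      · exact Or.inl (h₂.trans h₂')
      · exact Or.inr ⟨c, h.trans hc, hc'⟩
    · exact Or.inr ⟨c, hc, hc'.trans h'⟩

/-- A family of monotone maps that is constant over the image of `ξ` is monotone on the
relative cylinder. -/
theorem monotone_of_slices {Y : Type*} [Preorder Y] {θ : C → Y} {f : X × unitInterval → Y}
    (hf : ∀ u, Monotone fun x => f (x, u)) (hξ : ∀ c u, f (ξ c, u) = θ c) :
    Monotone (fun q : RelCylinder ξ => f q) := by
  rintro ⟨x, u⟩ ⟨x', u'⟩ ⟨h, rfl | ⟨c, hc, hc'⟩⟩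
  · exact hf _ h
  · calc f (x, u) ≤ f (ξ c, u) := hf u hc
      _ = f (ξ c, u') := by rw [hξ, hξ]
      _ ≤ f (x', u') := hf u' hc'

instance [TopologicalSpace X] : TopologicalSpace (RelCylinder ξ) :=
  inferInstanceAs (TopologicalSpace (X × unitInterval))

instance [TopologicalSpace X] :
    TopologicalSpace (Antisymmetrization (RelCylinder ξ) (· ≤ ·)) :=
  inferInstanceAs (TopologicalSpace (Quotient (AntisymmRel.setoid (RelCylinder ξ) (· ≤ ·))))

theorem continuous_toAntisymmetrization [TopologicalSpace X] :
    Continuous (toAntisymmetrization (α := RelCylinder ξ) (· ≤ ·)) :=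
  continuous_quotient_mk'

end RelCylinder

/-- A difibration lifts homotopies of `X × I` that are stationary over the image of `ξ`. -/
theorem IsDifib.exists_lift_prod_unitInterval {C E B : Type*}
    [TopologicalSpace C] [PartialOrder C] [TopologicalSpace E] [PartialOrder E]
    [TopologicalSpace B] [PartialOrder B] {ε : C → E} {β : C → B} {p : E → B}
    (hp : IsDifib.{u} ε β p) {X : Type u} [TopologicalSpace X] [PartialOrder X] {ξ : C → X}
    (hξ : IsDimap ξ) {f : X × unitInterval → E} (hf : Continuous f)
    (hfm : ∀ u, Monotone fun x => f (x, u)) (hfξ : ∀ c u, f (ξ c, u) = ε c)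
    {H : (X × unitInterval) × unitInterval → B} (hH : Continuous H)
    (hHm : ∀ u v, Monotone fun x => H ((x, u), v)) (hHf : ∀ q, H (q, 0) = p (f q))
    (hHξ : ∀ c u v, H ((ξ c, u), v) = β c) :
    ∃ G : (X × unitInterval) × unitInterval → E, Continuous G ∧
      (∀ u v, Monotone fun x => G ((x, u), v)) ∧ (∀ q, G (q, 0) = f q) ∧
      (∀ q v, p (G (q, v)) = H (q, v)) ∧ ∀ c u v, G ((ξ c, u), v) = ε c := by
  let π : X × unitInterval → Antisymmetrization (RelCylinder ξ) (· ≤ ·) :=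
    toAntisymmetrization (α := RelCylinder ξ) (· ≤ ·)
  have hπ : Continuous π := RelCylinder.continuous_toAntisymmetrization
  have hπm : ∀ u, Monotone fun x => π (x, u) := fun u x x' h =>
    (toAntisymmetrization_le_toAntisymmetrization_iff (α := RelCylinder ξ)).2
      ⟨h, Or.inl rfl⟩
  have hπξ : ∀ c u, π (ξ c, u) = π (ξ c, 0) := fun c u =>
    Quotient.sound ⟨⟨le_rfl, Or.inr ⟨c, le_rfl, le_rfl⟩⟩, ⟨le_rfl, Or.inr ⟨c, le_rfl, le_rfl⟩⟩⟩
  have hfmono : Monotone (fun q : RelCylinder ξ => f q) :=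
    RelCylinder.monotone_of_slices hfm hfξ
  have hHmono : ∀ v, Monotone (fun q : RelCylinder ξ => H (q, v)) := fun v =>
    RelCylinder.monotone_of_slices (f := fun q => H (q, v)) (hHm · v) (hHξ · · v)
  have hfresp : ∀ q q' : RelCylinder ξ, AntisymmRel (· ≤ ·) q q' → f q = f q' :=
    fun q q' h => (hfmono h.1).antisymm (hfmono h.2)
  have hHresp : ∀ v, ∀ q q' : RelCylinder ξ, AntisymmRel (· ≤ ·) q q' → H (q, v) = H (q', v) :=
    fun v q q' h => (hHmono v h.1).antisymm (hHmono v h.2)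
  let f' : Antisymmetrization (RelCylinder ξ) (· ≤ ·) → E := Quotient.lift _ hfresp
  let Hc : C(X × unitInterval, C(unitInterval, B)) := ContinuousMap.curry ⟨H, hH⟩
  let H' : Antisymmetrization (RelCylinder ξ) (· ≤ ·) → C(unitInterval, B) :=
    Quotient.lift (fun q : RelCylinder ξ => Hc q)
      fun q q' h => ContinuousMap.ext fun v => hHresp v q q' h
  have hf' : Continuous f' := continuous_quot_lift hfresp hf
  have hH' : Continuous H' := continuous_quot_lift _ Hc.continuous
  obtain ⟨G, hG, hGm, hG0, hGp, hGξ⟩ := hp.2 _ (fun c => π (ξ c, 0))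
    ⟨hπ.comp (hξ.1.prodMk continuous_const), fun _ _ h => hπm 0 (hξ.2 h)⟩ f'
    ⟨hf', by rintro ⟨q⟩ ⟨q'⟩ h; exact hfmono h, fun c => hfξ c 0⟩
    (fun z => H' z.1 z.2) (by fun_prop) (by rintro v ⟨q⟩ ⟨q'⟩ h; exact hHmono v h)
    (by rintro ⟨q⟩; exact hHf q) (fun c v => hHξ c 0 v)
  refine ⟨fun z => G (π z.1, z.2), by fun_prop, fun u v x x' h => hGm v (hπm u h),
    fun q => hG0 _, fun q v => hGp _ _, fun c u v => ?_⟩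
  simp only [hπξ, hGξ]

/-- Piecewise linear coordinates `(u, v)` on the unit square for which `v = 0` describes the three
sides `s = 0`, `t = 0` and `t = 1`, together with the formula recovering `(s, t)` from them. -/
theorem exists_three_sides_coordinates {s t : ℝ} (hs0 : 0 ≤ s) (hs1 : s ≤ 1) (ht0 : 0 ≤ t)
    (ht1 : t ≤ 1) :
    ∃ u v : ℝ, (0 ≤ u ∧ u ≤ 1) ∧ (0 ≤ v ∧ v ≤ 1) ∧
      (t - 1 / 2 - max 0 (s - 3 * t) + max 0 (s - 3 + 3 * t)) / 3 + 1 / 2 = u ∧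
      min s (min (3 * t) (3 * (1 - t))) = v ∧
      v + max 0 (|3 * u - 3 / 2| - (1 / 2 - v / 3)) = s ∧
      max (v / 3) (min (1 - v / 3) (3 * u - 1)) = t := by
  rcases le_total (3 * t) s with h | h
  · refine ⟨(4 * t - s - 1 / 2) / 3 + 1 / 2, 3 * t, ?_, ?_, ?_, ?_, ?_, ?_⟩
    · constructor <;> linarith
    · constructor <;> linarith
    · rw [max_eq_right (by linarith), max_eq_left (by linarith)]
      ring
    · rw [min_eq_left (b := 3 * (1 - t)) (by linarith), min_eq_right h]
    · rw [abs_of_nonpos (by linarith), max_eq_right (by linarith)]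
      ring
    · rw [min_eq_right (by linarith), max_eq_left (by linarith)]
      ring
  · rcases le_total (3 * (1 - t)) s with h' | h'
    · refine ⟨(4 * t + s - 3 - 1 / 2) / 3 + 1 / 2, 3 * (1 - t), ?_, ?_, ?_, ?_, ?_, ?_⟩
      · constructor <;> linarith
      · constructor <;> linarith
      · rw [max_eq_left (by linarith), max_eq_right (by linarith)]
        ring
      · rw [min_eq_right (a := 3 * t) (by linarith), min_eq_right h']
      · rw [abs_of_nonneg (by linarith), max_eq_right (by linarith)]
        ring
      · rw [min_eq_left (by linarith), max_eq_right (by linarith)]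
        ring
    · refine ⟨(t - 1 / 2) / 3 + 1 / 2, s, ?_, ?_, ?_, ?_, ?_, ?_⟩
      · constructor <;> linarith
      · constructor <;> linarith
      · rw [max_eq_left (by linarith), max_eq_left (by linarith)]
        ring
      · rw [min_eq_left (le_min h h')]
      · rw [max_eq_left, add_zero]
        rw [sub_nonpos, abs_le]
        constructor <;> linarith
      · rw [min_eq_right (by linarith), max_eq_right (by linarith)]
        ring

/-- The unit square is a retract of itself in such a way that three of its sides correspond to
one side. -/
theorem exists_retraction_unitSquare_three_sides :
    ∃ Φ Ψ : unitInterval × unitInterval → unitInterval × unitInterval,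
      Continuous Φ ∧ Continuous Ψ ∧ (∀ z, Φ (Ψ z) = z) ∧
      (∀ u, (Φ (u, 0)).1 = 0 ∨ (Φ (u, 0)).2 = 0 ∨ (Φ (u, 0)).2 = 1) ∧
      ∀ z : unitInterval × unitInterval, z.1 = 0 ∨ z.2 = 0 ∨ z.2 = 1 → (Ψ z).2 = 0 := by
  let pr : ℝ → unitInterval := Set.projIcc 0 1 zero_le_one
  have hpr : Continuous pr := continuous_projIcc
  have pr_coe : ∀ r, (pr r : ℝ) = max 0 (min 1 r) := fun r => Set.coe_projIcc ..
  let Φ : unitInterval × unitInterval → unitInterval × unitInterval := fun w =>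
    (pr (w.2 + max 0 (|3 * (w.1 : ℝ) - 3 / 2| - (1 / 2 - w.2 / 3))),
      pr (max (w.2 / 3 : ℝ) (min (1 - w.2 / 3) (3 * w.1 - 1))))
  let Ψ : unitInterval × unitInterval → unitInterval × unitInterval := fun z =>
    (pr ((z.2 - 1 / 2 - max 0 (z.1 - 3 * z.2 : ℝ) + max 0 (z.1 - 3 + 3 * z.2 : ℝ)) / 3 + 1 / 2),
      pr (min (z.1 : ℝ) (min (3 * z.2) (3 * (1 - z.2)))))
  refine ⟨Φ, Ψ, by fun_prop, by fun_prop, ?_, ?_, ?_⟩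
  · rintro ⟨⟨s, hs0, hs1⟩, ⟨t, ht0, ht1⟩⟩
    obtain ⟨u, v, ⟨hu0, hu1⟩, ⟨hv0, hv1⟩, hu, hv, hs, ht⟩ :=
      exists_three_sides_coordinates hs0 hs1 ht0 ht1
    ext <;> simp only [Φ, Ψ, pr_coe, hu, hv, min_eq_right hu1, max_eq_right hu0,
      min_eq_right hv1, max_eq_right hv0, hs, ht, min_eq_right hs1, max_eq_right hs0,
      min_eq_right ht1, max_eq_right ht0]
  · rintro ⟨u, hu0, hu1⟩
    simp only [Φ, Subtype.ext_iff, pr_coe, Set.Icc.coe_zero, Set.Icc.coe_one]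
    grind
  · rintro ⟨⟨s, hs0, hs1⟩, ⟨t, ht0, ht1⟩⟩ h
    simp only [Subtype.ext_iff, Set.Icc.coe_zero, Set.Icc.coe_one] at h
    simp only [Ψ, Subtype.ext_iff, pr_coe, Set.Icc.coe_zero]
    grind

/-- A map prescribed compatibly on three sides of a square of parameters. -/
theorem exists_glue_three_sides {X E : Type*} [TopologicalSpace X] [TopologicalSpace E]
    [PartialOrder X] [PartialOrder E] {f a b : X × unitInterval → E}
    (hf : Continuous f) (ha : Continuous a) (hb : Continuous b)
    (hfm : ∀ t, Monotone fun x => f (x, t)) (ham : ∀ t, Monotone fun x => a (x, t))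
    (hbm : ∀ t, Monotone fun x => b (x, t))
    (hfa : ∀ x, a (x, 0) = f (x, 0)) (hfb : ∀ x, b (x, 0) = f (x, 1)) :
    ∃ D : X × unitInterval × unitInterval → E,
      ContinuousOn D {z | z.2.1 = 0 ∨ z.2.2 = 0 ∨ z.2.2 = 1} ∧
      (∀ w, Monotone fun x => D (x, w)) ∧ (∀ x t, D (x, 0, t) = f (x, t)) ∧
      (∀ x s, D (x, s, 0) = a (x, s)) ∧ ∀ x s, D (x, s, 1) = b (x, s) := by
  classical
  let D : X × unitInterval × unitInterval → E := fun z =>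
    if z.2.1 = 0 then f (z.1, z.2.2) else if z.2.2 = 0 then a (z.1, z.2.1) else b (z.1, z.2.1)
  have hDf : ∀ x t, D (x, 0, t) = f (x, t) := fun x t => if_pos rfl
  have hDa : ∀ x s, D (x, s, 0) = a (x, s) := by
    intro x s
    by_cases h : s = 0
    · rw [h, hDf, hfa]
    · simp [D, h]
  have hDb : ∀ x s, D (x, s, 1) = b (x, s) := by
    intro x s
    by_cases h : s = 0
    · rw [h, hDf, hfb]
    · simp [D, h]
  refine ⟨D, ?_, ?_, hDf, hDa, hDb⟩
  · have h₁ : ContinuousOn D {z | z.2.1 = 0} :=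
      ContinuousOn.congr (f := fun z => f (z.1, z.2.2)) (by fun_prop) <| by
        rintro ⟨x, s, t⟩ (rfl : s = 0); exact hDf x t
    have h₂ : ContinuousOn D {z | z.2.2 = 0} :=
      ContinuousOn.congr (f := fun z => a (z.1, z.2.1)) (by fun_prop) <| by
        rintro ⟨x, s, t⟩ (rfl : t = 0); exact hDa x s
    have h₃ : ContinuousOn D {z | z.2.2 = 1} :=
      ContinuousOn.congr (f := fun z => b (z.1, z.2.1)) (by fun_prop) <| by
        rintro ⟨x, s, t⟩ (rfl : t = 1); exact hDb x s
    have c₁ : IsClosed {z : X × unitInterval × unitInterval | z.2.1 = 0} :=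
      isClosed_eq (by fun_prop) continuous_const
    have c₂ : IsClosed {z : X × unitInterval × unitInterval | z.2.2 = 0} :=
      isClosed_eq (by fun_prop) continuous_const
    have c₃ : IsClosed {z : X × unitInterval × unitInterval | z.2.2 = 1} :=
      isClosed_eq (by fun_prop) continuous_const
    exact h₁.union_of_isClosed (h₂.union_of_isClosed h₃ c₂ c₃) c₁ (c₂.union c₃)
  · rintro ⟨s, t⟩ x x' h
    simp only [D]
    split_ifs
    · exact hfm t h
    · exact ham s h
    · exact hbm s h

/-- For a `(C,≤)`-difibration `p : (E,≤,ε) → (B,≤,β)`, the map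
`(ev_0, ev_1, p^I) : (E^I,≤,c_ε) → (E × E) ×_{B × B} B^I` is a `(C,≤)`-difibration. -/
theorem isDifib_ev_ev_pathMap {C E B : Type*} [TopologicalSpace C] [PartialOrder C]
    [TopologicalSpace E] [PartialOrder E] [TopologicalSpace B] [PartialOrder B]
    (ε : C → E) (β : C → B) (hε : IsDimap ε) (hβ : IsDimap β)
    (p : E → B) (hp : IsDifib.{u} ε β p) :
    IsDifib.{u}
      (fun c => ContinuousMap.const unitInterval (ε c))
      (fun c => (⟨(ε c, ε c, ContinuousMap.const unitInterval (β c)),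
          (hp.1.2.2 c).symm, (hp.1.2.2 c).symm⟩ :
        {w : E × E × ContinuousMap unitInterval B // w.2.2 0 = p w.1 ∧ w.2.2 1 = p w.2.1}))
      (fun ω : ContinuousMap unitInterval E =>
        ⟨(ω 0, ω 1, ContinuousMap.comp ⟨p, hp.1.1⟩ ω), rfl, rfl⟩) := by
  refine ⟨⟨by fun_prop, fun ω ν h => ⟨h 0, h 1, fun t => hp.1.2.1 (h t)⟩, fun c => ?_⟩, ?_⟩
  · refine Subtype.ext (Prod.ext rfl (Prod.ext rfl (ContinuousMap.ext fun t => hp.1.2.2 c)))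
  intro X _ _ ξ hξ f ⟨hf, hfm, hfξ⟩ H hH hHm hH0 hHξ
  obtain ⟨Φ, Ψ, hΦ, hΨ, hΦΨ, hΦ0, hΨJ⟩ := exists_retraction_unitSquare_three_sides
  have hHv : Continuous fun z => (H z).1 := continuous_subtype_val.comp hH
  have hω : Continuous fun z => (H z).1.2.2 := by fun_prop
  obtain ⟨D, hD, hDm, hDf, hDa, hDb⟩ := exists_glue_three_sides
    (f := fun z => f z.1 z.2) (a := fun z => (H z).1.1) (b := fun z => (H z).1.2.1)
    (by fun_prop) (by fun_prop) (by fun_prop) (fun t x x' h => hfm h t)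
    (fun t x x' h => (hHm t h).1) (fun t x x' h => (hHm t h).2.1)
    (fun x => by simp only [hH0]) (fun x => by simp only [hH0])
  have hpD : ∀ x s t, s = 0 ∨ t = 0 ∨ t = 1 → p (D (x, s, t)) = (H (x, s)).1.2.2 t := by
    rintro x s t (rfl | rfl | rfl)
    · rw [hDf, hH0]; rfl
    · rw [hDa, (H (x, s)).2.1]
    · rw [hDb, (H (x, s)).2.2]
  have hDξ : ∀ c s t, s = 0 ∨ t = 0 ∨ t = 1 → D (ξ c, s, t) = ε c := by
    rintro c s t (rfl | rfl | rfl)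
    · rw [hDf, hfξ]; rfl
    · rw [hDa, hHξ]
    · rw [hDb, hHξ]
  obtain ⟨G, hG, hGm, hG0, hGp, hGξ⟩ := hp.exists_lift_prod_unitInterval hξ
    (f := fun q => D (q.1, Φ (q.2, 0)))
    (hD.comp_continuous (by fun_prop) fun q => hΦ0 q.2)
    (fun u => hDm (Φ (u, 0))) (fun c u => hDξ c _ _ (hΦ0 u))
    (H := fun z => (H (z.1.1, (Φ (z.1.2, z.2)).1)).1.2.2 (Φ (z.1.2, z.2)).2)
    (by fun_prop) (fun u v x x' h => (hHm _ h).2.2 _) (fun q => (hpD _ _ _ (hΦ0 q.2)).symm)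
    (fun c u v => by rw [hHξ]; rfl)
  let L : C((X × unitInterval) × unitInterval, E) :=
    ⟨fun z => G ((z.1.1, (Ψ (z.1.2, z.2)).1), (Ψ (z.1.2, z.2)).2), by fun_prop⟩
  have hLp : ∀ x s t, p (L ((x, s), t)) = (H (x, s)).1.2.2 t := fun x s t => by
    simp only [L, ContinuousMap.coe_mk, hGp, Prod.mk.eta, hΦΨ]
  have hLD : ∀ x s t, s = 0 ∨ t = 0 ∨ t = 1 → L ((x, s), t) = D (x, s, t) := by
    intro x s t h
    have h0 : (Ψ (s, t)).2 = 0 := hΨJ (s, t) h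
    have h1 : Φ ((Ψ (s, t)).1, 0) = (s, t) := by rw [← h0, Prod.mk.eta, hΦΨ]
    simp only [L, ContinuousMap.coe_mk, h0, hG0, h1]
  refine ⟨L.curry, L.curry.continuous, fun s x x' h t => hGm _ _ h,
    fun x => ContinuousMap.ext fun t => (hLD x 0 t (Or.inl rfl)).trans (hDf x t),
    fun x s => Subtype.ext (Prod.ext ?_ (Prod.ext ?_ (ContinuousMap.ext fun t => hLp x s t))),
    fun c s => ContinuousMap.ext fun t => hGξ c _ _⟩
  · exact (hLD x s 0 (Or.inr (Or.inl rfl))).trans (hDa x s)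
  · exact (hLD x s 1 (Or.inr (Or.inr rfl))).trans (hDb x s)
end

section
/- Let (C,≤) be a pospace and f : (X,≤,ξ) → (Y,≤,θ) a (C,≤)-dimap. Let W = {(x,ω) ∈ X × Y^I : ω(0) = f(x)} carry the subspace topology of the product, the componentwise partial order, and the structure dimap c ↦ (ξ(c), c_θ(c)). Then: (1) the map j : X → W, x ↦ (x, constant path at f(x)), is a dihomotopy equivalence relative to (C,≤); (2) the map q : W → Y, (x,ω) ↦ ω(1), is a (C,≤)-difibration; and (3) q ∘ j = f. In particular, every (C,≤)-dimap factors as a dihomotopy equivalence relative to (C,≤) followed by a (C,≤)-difibration. -/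
universe u

/-- The path obtained by following `ω` and then the time-`t` initial part of the path `η`,
parametrized so that it is `ω` itself for `t = 0`. -/
noncomputable def extendPath {Y : Type*} (ω η : unitInterval → Y) (t s : unitInterval) : Y :=
  if (s : ℝ) * (1 + t) ≤ 1 then ω (Set.projIcc 0 1 zero_le_one ((s : ℝ) * (1 + t)))
  else η (Set.projIcc 0 1 zero_le_one ((s : ℝ) * (1 + t) - 1))

lemma extendPath_start {Y : Type*} (ω η : unitInterval → Y) (t : unitInterval) :
    extendPath ω η t 0 = ω 0 := by
  simp [extendPath]

lemma extendPath_zero {Y : Type*} (ω η : unitInterval → Y) (s : unitInterval) :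
    extendPath ω η 0 s = ω s := by
  simp [extendPath, s.2.2]

lemma extendPath_end {Y : Type*} (ω η : unitInterval → Y) (h : ω 1 = η 0)
    (t : unitInterval) : extendPath ω η t 1 = η t := by
  unfold extendPath
  split_ifs with ht
  · have ht0 : t = 0 := le_antisymm (by
      have : (t : ℝ) ≤ 0 := by simpa using ht
      exact_mod_cast this) t.2.1
    simp [ht0, h]
  · simp

lemma extendPath_mono {Y : Type*} [Preorder Y] {ω ω' η η' : unitInterval → Y}
    (hω : ω ≤ ω') (hη : η ≤ η') (t s : unitInterval) :
    extendPath ω η t s ≤ extendPath ω' η' t s := by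
  unfold extendPath
  split_ifs
  · exact hω _
  · exact hη _

lemma continuous_extendPath {X Y : Type*} [TopologicalSpace X] [TopologicalSpace Y]
    {ω η : X → unitInterval → Y} (hω : Continuous (Function.uncurry ω))
    (hη : Continuous (Function.uncurry η)) (h : ∀ x, ω x 1 = η x 0) :
    Continuous fun p : (X × unitInterval) × unitInterval =>
      extendPath (ω p.1.1) (η p.1.1) p.1.2 p.2 := by
  unfold extendPath
  refine Continuous.if_le ?_ ?_ (by fun_prop) continuous_const ?_
  · exact hω.comp ((continuous_fst.comp continuous_fst).prodMk
      ((continuous_projIcc (h := zero_le_one)).comp (by fun_prop)))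
  · exact hη.comp ((continuous_fst.comp continuous_fst).prodMk
      ((continuous_projIcc (h := zero_le_one)).comp (by fun_prop)))
  · intro p hp
    simp [hp, h]

/-- Mapping path factorization of a `(C,≤)`-dimap `f : (X,≤,ξ) → (Y,≤,θ)`:
`j : X → W = X ×_Y Y^I` is a dihomotopy equivalence relative to `(C,≤)`, `q : W → Y`,
`(x,ω) ↦ ω(1)`, is a `(C,≤)`-difibration, and `q ∘ j = f`. -/
theorem mappingPath_factorization {C X Y : Type*} [TopologicalSpace C] [PartialOrder C]
    [TopologicalSpace X] [PartialOrder X] [TopologicalSpace Y] [PartialOrder Y]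
    (ξ : C → X) (θ : C → Y) (hξ : IsDimap ξ) (hθ : IsDimap θ)
    (f : X → Y) (hf : IsCDimap ξ θ f) :
    IsDihEquivRel ξ
      (fun c => (⟨(ξ c, ContinuousMap.const unitInterval (θ c)), (hf.2.2 c).symm⟩ :
        {w : X × ContinuousMap unitInterval Y // w.2 0 = f w.1}))
      (fun x => ⟨(x, ContinuousMap.const unitInterval (f x)), rfl⟩) ∧
    IsDifib.{u}
      (fun c => (⟨(ξ c, ContinuousMap.const unitInterval (θ c)), (hf.2.2 c).symm⟩ :
        {w : X × ContinuousMap unitInterval Y // w.2 0 = f w.1}))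
      θ
      (fun w : {w : X × ContinuousMap unitInterval Y // w.2 0 = f w.1} => w.1.2 1) ∧
    ∀ x : X,
      (fun w : {w : X × ContinuousMap unitInterval Y // w.2 0 = f w.1} => w.1.2 1)
        ⟨(x, ContinuousMap.const unitInterval (f x)), rfl⟩ = f x := by
  refine ⟨⟨⟨?_, ?_, ?_⟩, fun w => w.1.1, ⟨?_, ?_, ?_⟩, ?_, ?_⟩, ⟨⟨?_, ?_, ?_⟩, ?_⟩, fun x => rfl⟩
  · exact (continuous_id.prodMk (ContinuousMap.continuous_const'.comp hf.1)).subtype_mk _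
  · exact fun x y hxy => ⟨hxy, fun _ => hf.2.1 hxy⟩
  · intro c
    simp [hf.2.2 c]
  · fun_prop
  · exact fun w v hwv => hwv.1
  · exact fun c => rfl
  · exact ⟨Prod.fst, continuous_fst, fun _ _ _ h => h, fun _ => rfl, fun _ => rfl, fun _ _ => rfl⟩
  · let K : C({w : X × C(unitInterval, Y) // w.2 0 = f w.1} × unitInterval,
        C(unitInterval, Y)) := ContinuousMap.curry
      ⟨fun p => p.1.1.1.2 (p.1.2 * p.2), by fun_prop⟩
    refine ⟨fun p => ⟨(p.1.1.1, K p), ?_⟩, ?_, ?_, ?_, ?_, ?_⟩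
    · simpa [K] using p.1.2
    · exact Continuous.subtype_mk (by fun_prop) _
    · exact fun t w v hwv => ⟨hwv.1, fun s => hwv.2 (t * s)⟩
    · intro w
      refine Subtype.ext (Prod.ext rfl (ContinuousMap.ext fun s => ?_))
      simpa [K] using w.2
    · intro w
      refine Subtype.ext (Prod.ext rfl (ContinuousMap.ext fun s => ?_))
      simp [K]
    · exact fun c t => rfl
  · fun_prop
  · exact fun w v hwv => hwv.2 1
  · exact fun c => rfl
  · intro Z _ _ ζ _ g hg H hH hHm hH0 hHC
    have hgc : Continuous g := hg.1
    let K : C(Z × unitInterval, C(unitInterval, Y)) := ContinuousMap.curry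
      ⟨fun p => extendPath (g p.1.1).1.2 (fun s => H (p.1.1, s)) p.1.2 p.2,
        continuous_extendPath (ω := fun z => (g z).1.2) (η := fun z s => H (z, s))
          (by unfold Function.uncurry; fun_prop) hH fun z => (hH0 z).symm⟩
    refine ⟨fun p => ⟨((g p.1).1.1, K p), ?_⟩, ?_, ?_, ?_, ?_, ?_⟩
    · exact (extendPath_start (g p.1).1.2 (fun s => H (p.1, s)) p.2).trans (g p.1).2
    · exact Continuous.subtype_mk (by fun_prop) _
    · exact fun t z z' hz => ⟨(hg.2.1 hz).1,
        fun s => extendPath_mono (hg.2.1 hz).2 (fun r => hHm r hz) t s⟩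
    · exact fun z => Subtype.ext (Prod.ext rfl (ContinuousMap.ext fun s =>
        extendPath_zero (g z).1.2 (fun r => H (z, r)) s))
    · exact fun z t => extendPath_end (g z).1.2 (fun s => H (z, s)) (hH0 z).symm t
    · intro c t
      refine Subtype.ext (Prod.ext ?_ (ContinuousMap.ext fun s => ?_))
      · simp [hg.2.2 c]
      · simp [K, hg.2.2 c, hHC, extendPath]
end

section
/- Coequalizers exist in the category of pospaces: for any two dimaps f, g : (X,≤) → (Y,≤) there exist a pospace (Q,≤) and a dimap c : (Y,≤) → (Q,≤) with c ∘ f = c ∘ g such that for every pospace (Z,≤) and every dimap h : (Y,≤) → (Z,≤) with h ∘ f = h ∘ g there is a unique dimap u : (Q,≤) → (Z,≤) with u ∘ c = h. -/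
universe u v w

/-- Dihomotopy of dimaps between pospaces. -/
def Dih {X Y : Type*} [TopologicalSpace X] [PartialOrder X]
    [TopologicalSpace Y] [PartialOrder Y] (f g : X → Y) : Prop :=
  ∃ H : X × unitInterval → Y, Continuous H ∧ (∀ t, Monotone fun x => H (x, t)) ∧
    (∀ x, H (x, 0) = f x) ∧ ∀ x, H (x, 1) = g x

/-- Dihomotopy equivalence of pospaces. -/
def IsDihEquiv {X Y : Type*} [TopologicalSpace X] [PartialOrder X]
    [TopologicalSpace Y] [PartialOrder Y] (f : X → Y) : Prop :=
  IsDimap f ∧ ∃ g : Y → X, IsDimap g ∧ Dih (g ∘ f) id ∧ Dih (f ∘ g) id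

/-- A difibration of pospaces. -/
def IsDifibA {E B : Type*} [TopologicalSpace E] [PartialOrder E]
    [TopologicalSpace B] [PartialOrder B] (p : E → B) : Prop :=
  IsDimap p ∧
  ∀ (X : Type u) [TopologicalSpace X] [PartialOrder X] (f : X → E), IsDimap f →
    ∀ H : X × unitInterval → B, Continuous H → (∀ t, Monotone fun x => H (x, t)) →
      (∀ x, H (x, 0) = p (f x)) →
      ∃ G : X × unitInterval → E, Continuous G ∧ (∀ t, Monotone fun x => G (x, t)) ∧
        (∀ x, G (x, 0) = f x) ∧ ∀ x t, p (G (x, t)) = H (x, t)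

/-- A dicofibration of pospaces: a dimap with the left lifting property with respect to
all dimaps that are both difibrations and dihomotopy equivalences. -/
def IsDicofib {A X : Type*} [TopologicalSpace A] [PartialOrder A]
    [TopologicalSpace X] [PartialOrder X] (i : A → X) : Prop :=
  IsDimap i ∧
  ∀ (E : Type v) (B : Type w) [TopologicalSpace E] [PartialOrder E]
    [TopologicalSpace B] [PartialOrder B] (p : E → B),
    IsDifibA.{u} p → IsDihEquiv p →
    ∀ (f : A → E) (g : X → B), IsDimap f → IsDimap g → (∀ a, p (f a) = g (i a)) →
      ∃ lam : X → E, IsDimap lam ∧ (∀ a, lam (i a) = f a) ∧ ∀ x, p (lam x) = g x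

/-- A bundled partially ordered space. -/
structure Pospace : Type (u + 1) where
  carrier : Type u
  top : TopologicalSpace carrier
  ord : PartialOrder carrier

instance : CoeSort Pospace.{u} (Type u) := ⟨Pospace.carrier⟩
instance (P : Pospace.{u}) : TopologicalSpace P := P.top
instance (P : Pospace.{u}) : PartialOrder P := P.ord

/-- The reflexive transitive relation on `Y` generated by its order and the identifications
`f x ∼ g x`. -/
abbrev CoequalizerLE {X Y : Type*} [PartialOrder Y] (f g : X → Y) : Y → Y → Prop :=
  Relation.ReflTransGen fun a b =>
    a ≤ b ∨ ∃ x, (a = f x ∧ b = g x) ∨ (a = g x ∧ b = f x)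

/-- The preorder on `Y` whose antisymmetrization underlies the coequalizer of `f` and `g`. -/
abbrev coequalizerPreorder {X Y : Type*} [PartialOrder Y] (f g : X → Y) : Preorder Y where
  le := CoequalizerLE f g
  lt a b := CoequalizerLE f g a b ∧ ¬ CoequalizerLE f g b a
  le_refl _ := .refl
  le_trans _ _ _ := .trans

theorem le_of_coequalizerLE {X Y Z : Type*} [PartialOrder Y] [PartialOrder Z]
    {f g : X → Y} {h : Y → Z} (hm : Monotone h) (hfg : ∀ x, h (f x) = h (g x)) {a b : Y}
    (hab : CoequalizerLE f g a b) : h a ≤ h b := by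
  induction hab with
  | refl => exact le_rfl
  | tail _ hbc ih =>
    refine ih.trans ?_
    rcases hbc with hle | ⟨x, ⟨rfl, rfl⟩ | ⟨rfl, rfl⟩⟩
    · exact hm hle
    · exact (hfg x).le
    · exact (hfg x).ge

/-- Coequalizers exist in the category of pospaces. -/
theorem pospace_coequalizer {X Y : Type u} [TopologicalSpace X] [PartialOrder X]
    [TopologicalSpace Y] [PartialOrder Y]
    (f g : X → Y) (hf : IsDimap f) (hg : IsDimap g) :
    ∃ (Q : Pospace.{u}) (c : Y → Q), IsDimap c ∧ (∀ x, c (f x) = c (g x)) ∧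
      ∀ (Z : Type v) [TopologicalSpace Z] [PartialOrder Z] (h : Y → Z),
        IsDimap h → (∀ x, h (f x) = h (g x)) →
          ∃! u' : Q → Z, IsDimap u' ∧ ∀ y, u' (c y) = h y := by
  let s : Setoid Y := @AntisymmRel.setoid Y (coequalizerPreorder f g).le
    (@instIsPreorderLe Y (coequalizerPreorder f g))
  let o : PartialOrder (Quotient s) :=
    @instPartialOrderAntisymmetrization Y (coequalizerPreorder f g)
  refine ⟨⟨Quotient s, inferInstance, o⟩, Quotient.mk s,
    ⟨continuous_quotient_mk', fun _ _ hab => .single (.inl hab)⟩,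
    fun x => Quotient.sound ⟨.single (.inr ⟨x, .inl ⟨rfl, rfl⟩⟩),
      .single (.inr ⟨x, .inr ⟨rfl, rfl⟩⟩)⟩, ?_⟩
  intro Z _ _ h hh hfg
  have hwd : ∀ a b : Y, s a b → h a = h b := fun a b hab =>
    le_antisymm (le_of_coequalizerLE hh.2 hfg hab.1)
      (le_of_coequalizerLE hh.2 hfg hab.2)
  refine ⟨Quotient.lift h hwd, ⟨⟨hh.1.quotient_lift hwd, ?_⟩, fun _ => rfl⟩, ?_⟩
  · rintro ⟨a⟩ ⟨b⟩ hab
    exact le_of_coequalizerLE hh.2 hfg hab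
  · rintro u' ⟨_, hu⟩
    funext q
    induction q using Quotient.inductionOn with
    | h y => exact hu y
end

section
/- Let F be a fibration category in which every object is cofibrant and *-fibrant and in which a morphism is a weak equivalence if and only if it is a homotopy equivalence. Then a morphism of F is a trivial cofibration (a cofibration that is also a weak equivalence) if and only if it has the left lifting property with respect to all fibrations. -/
open CategoryTheory CategoryTheory.Limits

universe v u

/-- A fibration category in the sense of Baues, with a final object. -/
structure BauesFibCat (𝒞 : Type u) [Category.{v} 𝒞] where
  /-- weak equivalences -/
  weq : MorphismProperty 𝒞
  /-- fibrations -/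
  fib : MorphismProperty 𝒞
  /-- the final object `*` -/
  pt : 𝒞
  ptIsTerminal : IsTerminal pt
  /-- F1: isomorphisms are trivial fibrations -/
  iso_trivFib : ∀ {X Y : 𝒞} (f : X ⟶ Y), IsIso f → fib f ∧ weq f
  /-- F1: fibrations compose -/
  fib_comp : ∀ {X Y Z : 𝒞} (f : X ⟶ Y) (g : Y ⟶ Z), fib f → fib g → fib (f ≫ g)
  /-- F1: two-out-of-three -/
  weq_comp : ∀ {X Y Z : 𝒞} (f : X ⟶ Y) (g : Y ⟶ Z), weq f → weq g → weq (f ≫ g)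
  weq_of_comp_left : ∀ {X Y Z : 𝒞} (f : X ⟶ Y) (g : Y ⟶ Z), weq f → weq (f ≫ g) → weq g
  weq_of_comp_right : ∀ {X Y Z : 𝒞} (f : X ⟶ Y) (g : Y ⟶ Z), weq g → weq (f ≫ g) → weq f
  /-- F2: pullbacks along fibrations exist -/
  hasPullback : ∀ {X Y Z : 𝒞} (f : X ⟶ Z) (p : Y ⟶ Z), fib p → HasPullback f p
  /-- F2: fibrations are stable under base change -/
  fib_baseChange : ∀ {P X Y Z : 𝒞} (fst : P ⟶ X) (snd : P ⟶ Y) (f : X ⟶ Z) (p : Y ⟶ Z),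
    IsPullback fst snd f p → fib p → fib fst
  /-- F2: trivial fibrations are stable under base change -/
  trivFib_baseChange : ∀ {P X Y Z : 𝒞} (fst : P ⟶ X) (snd : P ⟶ Y) (f : X ⟶ Z) (p : Y ⟶ Z),
    IsPullback fst snd f p → fib p → weq p → fib fst ∧ weq fst
  /-- F2: the base extension of a weak equivalence along a fibration is a weak equivalence -/
  weq_baseChange : ∀ {P X Y Z : 𝒞} (fst : P ⟶ X) (snd : P ⟶ Y) (f : X ⟶ Z) (p : Y ⟶ Z),
    IsPullback fst snd f p → fib p → weq f → weq snd
  /-- F3: factorization into a weak equivalence followed by a fibration -/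
  factorization : ∀ {X Y : 𝒞} (f : X ⟶ Y), ∃ (W : 𝒞) (j : X ⟶ W) (q : W ⟶ Y),
    weq j ∧ fib q ∧ j ≫ q = f
  /-- F4: cofibrant models -/
  cofibrantModels : ∀ X : 𝒞, ∃ (Y : 𝒞) (q : Y ⟶ X), fib q ∧ weq q ∧
    ∀ {E : 𝒞} (p : E ⟶ Y), fib p → weq p → ∃ s : Y ⟶ E, s ≫ p = 𝟙 Y

variable {𝒞 : Type u} [Category.{v} 𝒞]

/-- An object is cofibrant if every trivial fibration onto it admits a section. -/
def BauesFibCat.Cofibrant (F : BauesFibCat 𝒞) (X : 𝒞) : Prop :=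
  ∀ {E : 𝒞} (p : E ⟶ X), F.fib p → F.weq p → ∃ s : X ⟶ E, s ≫ p = 𝟙 X

/-- Two morphisms `f g : X ⟶ E` are homotopic if for some factorization of the diagonal
`(𝟙 E, 𝟙 E) : E ⟶ E × E` into a weak equivalence followed by a fibration `q : P ⟶ E × E`
there is a morphism `h : X ⟶ P` with `q ∘ h = (f, g)`. -/
def BauesFibCat.Homotopic (F : BauesFibCat 𝒞) {X E : 𝒞} (f g : X ⟶ E) : Prop :=
  ∃ (Q : 𝒞) (π₁ π₂ : Q ⟶ E) (d : E ⟶ Q),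
    Nonempty (IsLimit (BinaryFan.mk π₁ π₂)) ∧ d ≫ π₁ = 𝟙 E ∧ d ≫ π₂ = 𝟙 E ∧
    ∃ (P : 𝒞) (w : E ⟶ P) (q : P ⟶ Q), F.weq w ∧ F.fib q ∧ w ≫ q = d ∧
      ∃ h : X ⟶ P, h ≫ (q ≫ π₁) = f ∧ h ≫ (q ≫ π₂) = g

/-- A homotopy equivalence: a morphism invertible up to homotopy. -/
def BauesFibCat.HomotopyEquiv (F : BauesFibCat 𝒞) {X Y : 𝒞} (f : X ⟶ Y) : Prop :=
  ∃ g : Y ⟶ X, F.Homotopic (f ≫ g) (𝟙 X) ∧ F.Homotopic (g ≫ f) (𝟙 Y)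

/-- A cofibration: a morphism with the left lifting property with respect to all
trivial fibrations. -/
def BauesFibCat.Cofib (F : BauesFibCat 𝒞) {A X : 𝒞} (i : A ⟶ X) : Prop :=
  ∀ {E B : 𝒞} (p : E ⟶ B), F.fib p → F.weq p →
    ∀ (f : A ⟶ E) (g : X ⟶ B), i ≫ g = f ≫ p →
      ∃ lam : X ⟶ E, i ≫ lam = f ∧ lam ≫ p = g

namespace BauesFibCat

/-- Every object whose map to the final object is a fibration has a path object. -/
theorem exists_pathObject (F : BauesFibCat 𝒞) {E : 𝒞} (hE : F.fib (F.ptIsTerminal.from E)) :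
    ∃ (Q : 𝒞) (π₁ π₂ : Q ⟶ E) (d : E ⟶ Q),
      Nonempty (IsLimit (BinaryFan.mk π₁ π₂)) ∧ d ≫ π₁ = 𝟙 E ∧ d ≫ π₂ = 𝟙 E ∧
      ∃ (P : 𝒞) (w : E ⟶ P) (q : P ⟶ Q), F.weq w ∧ F.fib q ∧ w ≫ q = d := by
  have := F.hasPullback (F.ptIsTerminal.from E) (F.ptIsTerminal.from E) hE
  have hQ := IsPullback.of_hasPullback (F.ptIsTerminal.from E) (F.ptIsTerminal.from E)
  let d := hQ.lift (𝟙 E) (𝟙 E) rfl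
  obtain ⟨P, w, q, hw, hq, hwq⟩ := F.factorization d
  exact ⟨_, _, _, d, ⟨isProductOfIsTerminalIsPullback _ _ _ _ F.ptIsTerminal hQ.isLimit⟩,
    hQ.lift_fst _ _ _, hQ.lift_snd _ _ _, P, w, q, hw, hq, hwq⟩

theorem Homotopic.refl (F : BauesFibCat 𝒞) {X E : 𝒞} (hE : F.fib (F.ptIsTerminal.from E))
    (f : X ⟶ E) : F.Homotopic f f := by
  obtain ⟨Q, π₁, π₂, d, hQ, h₁, h₂, P, w, q, hw, hq, hwq⟩ := F.exists_pathObject hE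
  refine ⟨Q, π₁, π₂, d, hQ, h₁, h₂, P, w, q, hw, hq, hwq, f ≫ w, ?_, ?_⟩
  · rw [Category.assoc, reassoc_of% hwq, h₁, Category.comp_id]
  · rw [Category.assoc, reassoc_of% hwq, h₂, Category.comp_id]

/-- A morphism between `*`-fibrant objects with the left lifting property with respect to all
fibrations is a homotopy equivalence. -/
theorem homotopyEquiv_of_llp (F : BauesFibCat 𝒞) {A X : 𝒞} (i : A ⟶ X)
    (hA : F.fib (F.ptIsTerminal.from A)) (hX : F.fib (F.ptIsTerminal.from X))
    (hi : ∀ {E B : 𝒞} (p : E ⟶ B), F.fib p →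
      ∀ (f : A ⟶ E) (g : X ⟶ B), i ≫ g = f ≫ p →
        ∃ lam : X ⟶ E, i ≫ lam = f ∧ lam ≫ p = g) :
    F.HomotopyEquiv i := by
  obtain ⟨r, hr, -⟩ := hi _ hA (𝟙 A) (F.ptIsTerminal.from X) (F.ptIsTerminal.hom_ext _ _)
  obtain ⟨Q, π₁, π₂, d, ⟨hQ⟩, h₁, h₂, P, w, q, hw, hq, hwq⟩ := F.exists_pathObject hX
  obtain ⟨e, he₁, he₂⟩ : ∃ e : X ⟶ Q, e ≫ π₁ = r ≫ i ∧ e ≫ π₂ = 𝟙 X :=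
    ⟨_, (BinaryFan.IsLimit.lift' hQ (r ≫ i) (𝟙 X)).2⟩
  obtain ⟨h, -, hh⟩ := hi q hq (i ≫ w) e (BinaryFan.IsLimit.hom_ext hQ
    (by simp [he₁, reassoc_of% hwq, h₁, reassoc_of% hr])
    (by simp [he₂, reassoc_of% hwq, h₂]))
  exact ⟨r, hr ▸ Homotopic.refl F hA _, Q, π₁, π₂, d, ⟨hQ⟩, h₁, h₂, P, w, q, hw, hq, hwq, h,
    by rw [reassoc_of% hh, he₁], by rw [reassoc_of% hh, he₂]⟩

/-- A trivial cofibration has the left lifting property with respect to all fibrations. -/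
theorem Cofib.exists_lift {F : BauesFibCat 𝒞} {A X : 𝒞} {i : A ⟶ X} (hi : F.Cofib i)
    (hiw : F.weq i) {E B : 𝒞} (p : E ⟶ B) (hp : F.fib p) (f : A ⟶ E) (g : X ⟶ B)
    (sq : i ≫ g = f ≫ p) : ∃ lam : X ⟶ E, i ≫ lam = f ∧ lam ≫ p = g := by
  have := F.hasPullback g p hp
  have hP := IsPullback.of_hasPullback g p
  obtain ⟨W, j, u, hj, hu, hju⟩ := F.factorization (hP.lift i f sq)
  have hjq : j ≫ u ≫ pullback.fst g p = i := by rw [reassoc_of% hju, hP.lift_fst]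
  obtain ⟨s, hs, hs'⟩ := hi (u ≫ pullback.fst g p)
    (F.fib_comp _ _ hu (F.fib_baseChange _ _ _ _ hP hp))
    (F.weq_of_comp_left j _ hj (hjq.symm ▸ hiw)) j (𝟙 X) (by rw [hjq, Category.comp_id])
  refine ⟨s ≫ u ≫ pullback.snd g p, ?_, ?_⟩
  · rw [reassoc_of% hs, reassoc_of% hju, hP.lift_snd]
  · simp only [Category.assoc, ← hP.w]
    simpa using hs' =≫ g

end BauesFibCat

/-- In a fibration category in which all objects are cofibrant and `*`-fibrant
and in which the weak equivalences are exactly the homotopy equivalences, a morphism is a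
trivial cofibration iff it has the left lifting property with respect to all fibrations. -/
theorem trivialCofibration_iff_llp (F : BauesFibCat 𝒞)
    (hcof : ∀ X : 𝒞, F.Cofibrant X)
    (hfib : ∀ X : 𝒞, F.fib (F.ptIsTerminal.from X))
    (hweq : ∀ {X Y : 𝒞} (f : X ⟶ Y), F.weq f ↔ F.HomotopyEquiv f)
    {A X : 𝒞} (i : A ⟶ X) :
    (F.Cofib i ∧ F.weq i) ↔
      (∀ {E B : 𝒞} (p : E ⟶ B), F.fib p →
        ∀ (f : A ⟶ E) (g : X ⟶ B), i ≫ g = f ≫ p →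
          ∃ lam : X ⟶ E, i ≫ lam = f ∧ lam ≫ p = g) := by
  exact ⟨fun ⟨hi, hiw⟩ _ _ p hp f g sq => hi.exists_lift hiw p hp f g sq,
    fun hi => ⟨fun p hp _ => hi p hp,
      (hweq i).2 (F.homotopyEquiv_of_llp i (hfib A) (hfib X) hi)⟩⟩
end

section
/- Let F be a fibration category in which every object is cofibrant and *-fibrant and in which a morphism is a weak equivalence if and only if it is a homotopy equivalence. Suppose in addition that F has an initial object ∅, that the pushout of two morphisms one of which is a cofibration exists, and that for every object X the fold morphism (id_X, id_X) : X ⊔ X → X admits a factorization into a cofibration followed by a weak equivalence. Then F, equipped with the same weak equivalences and with the cofibrations (morphisms having the left lifting property with respect to trivial fibrations), is a cofibration category, and all objects of this cofibration category are ∅-cofibrant and fibrant. -/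
open CategoryTheory CategoryTheory.Limits

universe v u

variable {𝒞 : Type u} [Category.{v} 𝒞]

theorem exists_lift_of_isLimit_mk {X Y Q W : 𝒞} {π₁ : Q ⟶ X} {π₂ : Q ⟶ Y}
    (hQ : IsLimit (BinaryFan.mk π₁ π₂)) (f : W ⟶ X) (g : W ⟶ Y) :
    ∃ l : W ⟶ Q, l ≫ π₁ = f ∧ l ≫ π₂ = g :=
  ⟨_, (BinaryFan.IsLimit.lift' hQ f g).2⟩

theorem hom_ext_of_isLimit_mk {X Y Q W : 𝒞} {π₁ : Q ⟶ X} {π₂ : Q ⟶ Y}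
    (hQ : IsLimit (BinaryFan.mk π₁ π₂)) {k l : W ⟶ Q} (h₁ : k ≫ π₁ = l ≫ π₁)
    (h₂ : k ≫ π₂ = l ≫ π₂) : k = l :=
  BinaryFan.IsLimit.hom_ext hQ h₁ h₂

theorem exists_desc_of_isColimit_mk {X Y S W : 𝒞} {in₁ : X ⟶ S} {in₂ : Y ⟶ S}
    (hS : IsColimit (BinaryCofan.mk in₁ in₂)) (f : X ⟶ W) (g : Y ⟶ W) :
    ∃ l : S ⟶ W, in₁ ≫ l = f ∧ in₂ ≫ l = g :=
  ⟨_, (BinaryCofan.IsColimit.desc' hS f g).2⟩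

theorem hom_ext_of_isColimit_mk {X Y S W : 𝒞} {in₁ : X ⟶ S} {in₂ : Y ⟶ S}
    (hS : IsColimit (BinaryCofan.mk in₁ in₂)) {k l : S ⟶ W} (h₁ : in₁ ≫ k = in₁ ≫ l)
    (h₂ : in₂ ≫ k = in₂ ≫ l) : k = l :=
  BinaryCofan.IsColimit.hom_ext hS h₁ h₂

namespace BauesFibCat

variable {F : BauesFibCat 𝒞}

/-- A square from a weak equivalence to a fibration factors through a trivial fibration. -/
theorem exists_trivFib_of_square {A B V D : 𝒞} {a : A ⟶ B} {p : V ⟶ D} {u : A ⟶ V} {b : B ⟶ D}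
    (ha : F.weq a) (hp : F.fib p) (h : u ≫ p = a ≫ b) :
    ∃ (R : 𝒞) (c : A ⟶ R) (r : R ⟶ B) (t : R ⟶ V),
      F.fib r ∧ F.weq r ∧ c ≫ r = a ∧ c ≫ t = u ∧ t ≫ p = r ≫ b := by
  have := F.hasPullback b p hp
  have sq := IsPullback.of_hasPullback b p
  obtain ⟨k, hk₁, hk₂⟩ := sq.exists_lift a u h.symm
  obtain ⟨R, c, r, hc, hr, hcr⟩ := F.factorization k
  have hcr' : c ≫ r ≫ pullback.fst b p = a := by rw [← Category.assoc, hcr, hk₁]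
  refine ⟨R, c, r ≫ pullback.fst b p, r ≫ pullback.snd b p,
    F.fib_comp _ _ hr (F.fib_baseChange _ _ _ _ sq hp),
    F.weq_of_comp_left c _ hc (by rwa [hcr']), hcr', ?_, ?_⟩
  · rw [← Category.assoc, hcr, hk₂]
  · simp [sq.w]

/-- When all objects are cofibrant, weak equivalences lift against fibrations, up to
commutativity of the upper triangle. -/
theorem exists_lift_lower (hcof : ∀ X : 𝒞, F.Cofibrant X) {A B V D : 𝒞} {a : A ⟶ B}
    {p : V ⟶ D} {u : A ⟶ V} {b : B ⟶ D} (ha : F.weq a) (hp : F.fib p) (h : u ≫ p = a ≫ b) :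
    ∃ l : B ⟶ V, l ≫ p = b := by
  obtain ⟨R, c, r, t, hr, hr', -, -, htp⟩ := exists_trivFib_of_square ha hp h
  obtain ⟨s, hs⟩ := hcof B r hr hr'
  exact ⟨s ≫ t, by rw [Category.assoc, htp, ← Category.assoc, hs, Category.id_comp]⟩

/-- Every morphism lifts through a trivial fibration when all objects are cofibrant. -/
theorem exists_lift_trivFib (hcof : ∀ X : 𝒞, F.Cofibrant X) {X E B : 𝒞} {p : E ⟶ B}
    (hp : F.fib p) (hp' : F.weq p) (g : X ⟶ B) : ∃ l : X ⟶ E, l ≫ p = g := by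
  have := F.hasPullback g p hp
  have sq := IsPullback.of_hasPullback g p
  obtain ⟨h₁, h₂⟩ := F.trivFib_baseChange _ _ _ _ sq hp hp'
  obtain ⟨s, hs⟩ := hcof X _ h₁ h₂
  exact ⟨s ≫ pullback.snd g p,
    by rw [Category.assoc, ← sq.w, ← Category.assoc, hs, Category.id_comp]⟩

/-- The left lifting property with respect to all fibrations. -/
def LiftsFib (F : BauesFibCat 𝒞) {A X : 𝒞} (i : A ⟶ X) : Prop :=
  ∀ {E B : 𝒞} (p : E ⟶ B), F.fib p → ∀ (f : A ⟶ E) (g : X ⟶ B), i ≫ g = f ≫ p →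
    ∃ l : X ⟶ E, i ≫ l = f ∧ l ≫ p = g

theorem Cofib.liftsFib {A X : 𝒞} {i : A ⟶ X} (hi : F.Cofib i) (hi' : F.weq i) :
    F.LiftsFib i := by
  intro E B p hp f g h
  obtain ⟨R, c, r, t, hr, hr', hcr, hct, htp⟩ := exists_trivFib_of_square hi' hp h.symm
  obtain ⟨s, hs, hs'⟩ := hi r hr hr' c (𝟙 X) (by rw [hcr, Category.comp_id])
  exact ⟨s ≫ t, by rw [← Category.assoc, hs, hct],
    by rw [Category.assoc, htp, ← Category.assoc, hs', Category.id_comp]⟩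

theorem LiftsFib.cobaseChange {P X Y Z : 𝒞} {f : Z ⟶ X} {g : Z ⟶ Y} {inl : X ⟶ P}
    {inr : Y ⟶ P} (sq : IsPushout f g inl inr) (hg : F.LiftsFib g) : F.LiftsFib inl := by
  intro E B p hp a b h
  obtain ⟨l, hl, hl'⟩ := hg p hp (f ≫ a) (inr ≫ b)
    (by rw [← Category.assoc, ← sq.w, Category.assoc, h, Category.assoc])
  obtain ⟨m, hm, hm'⟩ := sq.exists_desc a l hl.symm
  refine ⟨m, hm, sq.hom_ext ?_ ?_⟩
  · rw [← Category.assoc, hm, h]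
  · rw [← Category.assoc, hm', hl']

theorem Cofib.cobaseChange {P X Y Z : 𝒞} {f : Z ⟶ X} {g : Z ⟶ Y} {inl : X ⟶ P}
    {inr : Y ⟶ P} (sq : IsPushout f g inl inr) (hg : F.Cofib g) : F.Cofib inl := by
  intro E B p hp hp' a b h
  obtain ⟨l, hl, hl'⟩ := hg p hp hp' (f ≫ a) (inr ≫ b)
    (by rw [← Category.assoc, ← sq.w, Category.assoc, h, Category.assoc])
  obtain ⟨m, hm, hm'⟩ := sq.exists_desc a l hl.symm
  refine ⟨m, hm, sq.hom_ext ?_ ?_⟩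
  · rw [← Category.assoc, hm, h]
  · rw [← Category.assoc, hm', hl']

theorem Cofib.comp {X Y Z : 𝒞} {f : X ⟶ Y} {g : Y ⟶ Z} (hf : F.Cofib f) (hg : F.Cofib g) :
    F.Cofib (f ≫ g) := by
  intro E B p hp hp' a b h
  obtain ⟨l, hl, hl'⟩ := hf p hp hp' a (g ≫ b) (by rw [← h, Category.assoc])
  obtain ⟨m, hm, hm'⟩ := hg p hp hp' l b hl'.symm
  exact ⟨m, by rw [Category.assoc, hm, hl], hm'⟩

theorem cofib_of_isIso (F : BauesFibCat 𝒞) {X Y : 𝒞} (f : X ⟶ Y) [IsIso f] : F.Cofib f := by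
  intro E B p _ _ a b h
  exact ⟨inv f ≫ a, by simp, by rw [Category.assoc, ← h, IsIso.inv_hom_id_assoc]⟩

theorem weq_id (F : BauesFibCat 𝒞) (X : 𝒞) : F.weq (𝟙 X) := (F.iso_trivFib _ inferInstance).2

theorem weq_of_section {X Y : 𝒞} {s : X ⟶ Y} {r : Y ⟶ X} (h : s ≫ r = 𝟙 X) (hr : F.weq r) :
    F.weq s :=
  F.weq_of_comp_right s r hr (h ▸ F.weq_id X)

theorem weq_of_retraction {X Y : 𝒞} {s : X ⟶ Y} {r : Y ⟶ X} (h : s ≫ r = 𝟙 X) (hs : F.weq s) :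
    F.weq r :=
  F.weq_of_comp_left s r hs (h ▸ F.weq_id X)

/-- Binary products of `*`-fibrant objects exist and have fibrations as projections. -/
theorem exists_product (hfib : ∀ X : 𝒞, F.fib (F.ptIsTerminal.from X)) (X Y : 𝒞) :
    ∃ (Q : 𝒞) (π₁ : Q ⟶ X) (π₂ : Q ⟶ Y), Nonempty (IsLimit (BinaryFan.mk π₁ π₂)) ∧
      F.fib π₁ ∧ F.fib π₂ := by
  have := F.hasPullback (F.ptIsTerminal.from X) (F.ptIsTerminal.from Y) (hfib Y)
  have sq := IsPullback.of_hasPullback (F.ptIsTerminal.from X) (F.ptIsTerminal.from Y)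
  exact ⟨_, _, _, ⟨isProductOfIsTerminalIsPullback _ _ _ _ F.ptIsTerminal sq.isLimit⟩,
    F.fib_baseChange _ _ _ _ sq (hfib Y), F.fib_baseChange _ _ _ _ sq.flip (hfib X)⟩

/-- A homotopy through any object weakly equivalent to the target can be replaced by one
through a path object. -/
theorem homotopic_of_weq (hfib : ∀ X : 𝒞, F.fib (F.ptIsTerminal.from X)) {X E M : 𝒞}
    {c : E ⟶ M} {m₀ m₁ : M ⟶ E} (hc : F.weq c) (h₀ : c ≫ m₀ = 𝟙 E) (h₁ : c ≫ m₁ = 𝟙 E)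
    (h : X ⟶ M) : F.Homotopic (h ≫ m₀) (h ≫ m₁) := by
  obtain ⟨Q, π₁, π₂, ⟨hQ⟩, -, -⟩ := F.exists_product hfib E E
  obtain ⟨m, hm₀, hm₁⟩ := exists_lift_of_isLimit_mk hQ m₀ m₁
  obtain ⟨P, j, q, hj, hq, hjq⟩ := F.factorization m
  refine ⟨Q, π₁, π₂, c ≫ m, ⟨hQ⟩, by rw [Category.assoc, hm₀, h₀],
    by rw [Category.assoc, hm₁, h₁], P, c ≫ j, q, F.weq_comp _ _ hc hj, hq,
    by rw [Category.assoc, hjq], h ≫ j, ?_, ?_⟩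
  · rw [Category.assoc, ← Category.assoc j, hjq, hm₀]
  · rw [Category.assoc, ← Category.assoc j, hjq, hm₁]

theorem homotopic_refl (hfib : ∀ X : 𝒞, F.fib (F.ptIsTerminal.from X)) {X E : 𝒞}
    (f : X ⟶ E) : F.Homotopic f f := by
  simpa using homotopic_of_weq hfib (F.weq_id E) (Category.id_comp _) (Category.id_comp _) f

theorem Homotopic.exists_homotopy (hfib : ∀ X : 𝒞, F.fib (F.ptIsTerminal.from X)) {X E : 𝒞}
    {f g : X ⟶ E} (h : F.Homotopic f g) :
    ∃ (P : 𝒞) (w : E ⟶ P) (p₀ p₁ : P ⟶ E) (k : X ⟶ P), F.weq w ∧ F.fib p₀ ∧ w ≫ p₀ = 𝟙 E ∧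
      w ≫ p₁ = 𝟙 E ∧ k ≫ p₀ = f ∧ k ≫ p₁ = g := by
  obtain ⟨Q, π₁, π₂, d, ⟨hQ⟩, hd₁, hd₂, P, w, q, hw, hq, hwq, k, hk₁, hk₂⟩ := h
  exact ⟨P, w, q ≫ π₁, q ≫ π₂, k, hw, F.fib_comp _ _ hq
      (F.fib_baseChange _ _ _ _ (IsPullback.of_is_product' hQ F.ptIsTerminal) (hfib E)),
    by rw [← Category.assoc, hwq, hd₁], by rw [← Category.assoc, hwq, hd₂], hk₁, hk₂⟩

/-- A split idempotent which is a weak equivalence is split by weak equivalences. -/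
theorem weq_of_weq_idempotent (hfib : ∀ X : 𝒞, F.fib (F.ptIsTerminal.from X))
    (hweq : ∀ {X Y : 𝒞} (f : X ⟶ Y), F.weq f ↔ F.HomotopyEquiv f) {W P : 𝒞} {q : W ⟶ P}
    {t : P ⟶ W} (htq : t ≫ q = 𝟙 P) (h : F.weq (q ≫ t)) : F.weq q := by
  obtain ⟨e, he, -⟩ := (hweq _).1 h
  obtain ⟨V, w, p₀, p₁, k, hw, hp₀, hw₀, hw₁, hk₀, hk₁⟩ := he.exists_homotopy hfib
  have hp₀' : F.weq p₀ := weq_of_retraction hw₀ hw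
  have := F.hasPullback p₀ p₀ hp₀
  have sq := IsPullback.of_hasPullback p₀ p₀
  obtain ⟨c, hc₁, hc₂⟩ := sq.exists_lift w w rfl
  have hc : F.weq c := F.weq_of_comp_right _ _
    (F.trivFib_baseChange _ _ _ _ sq hp₀ hp₀').2 (by rwa [hc₁])
  obtain ⟨l, hl₁, hl₂⟩ := sq.exists_lift ((q ≫ t) ≫ k) k (by
    rw [Category.assoc, hk₀, Category.assoc, Category.assoc, ← Category.assoc t q, htq,
      Category.id_comp])
  have key := homotopic_of_weq hfib (m₀ := pullback.fst p₀ p₀ ≫ p₁)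
    (m₁ := pullback.snd p₀ p₀ ≫ p₁) hc
    (by rw [← Category.assoc, hc₁, hw₁]) (by rw [← Category.assoc, hc₂, hw₁]) l
  rw [← Category.assoc, ← Category.assoc, hl₁, hl₂, Category.assoc, hk₁, Category.comp_id] at key
  exact (hweq q).2 ⟨t, key, htq ▸ homotopic_refl hfib _⟩

theorem LiftsFib.weq (hfib : ∀ X : 𝒞, F.fib (F.ptIsTerminal.from X))
    (hweq : ∀ {X Y : 𝒞} (f : X ⟶ Y), F.weq f ↔ F.HomotopyEquiv f) {X P : 𝒞} {k : X ⟶ P}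
    (hk : F.LiftsFib k) : F.weq k := by
  obtain ⟨r, hr, -⟩ := hk (F.ptIsTerminal.from X) (hfib X) (𝟙 X) (F.ptIsTerminal.from P)
    (F.ptIsTerminal.hom_ext _ _)
  obtain ⟨Q, π₁, π₂, ⟨hQ⟩, -, -⟩ := F.exists_product hfib P P
  obtain ⟨d, hd₁, hd₂⟩ := exists_lift_of_isLimit_mk hQ (𝟙 P) (𝟙 P)
  obtain ⟨b, hb₁, hb₂⟩ := exists_lift_of_isLimit_mk hQ (r ≫ k) (𝟙 P)
  obtain ⟨V, w, q, hw, hq, hwq⟩ := F.factorization d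
  obtain ⟨l, -, hl⟩ := hk q hq (k ≫ w) b (by
    refine hom_ext_of_isLimit_mk hQ ?_ ?_
    · rw [Category.assoc, hb₁, ← Category.assoc, hr, Category.id_comp, Category.assoc, Category.assoc,
        ← Category.assoc w, hwq, hd₁, Category.comp_id]
    · rw [Category.assoc, hb₂, Category.assoc, Category.assoc, ← Category.assoc w, hwq, hd₂])
  refine (hweq k).2 ⟨r, hr ▸ homotopic_refl hfib _, Q, π₁, π₂, d, ⟨hQ⟩, hd₁, hd₂, V, w, q, hw,
    hq, hwq, l, ?_, ?_⟩
  · rw [← Category.assoc, hl]; exact hb₁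
  · rw [← Category.assoc, hl]; exact hb₂

/-- The cobase extension of a trivial fibration along a cofibration is a weak equivalence. -/
theorem weq_cobaseChange_of_trivFib (hcof : ∀ X : 𝒞, F.Cofibrant X)
    (hfib : ∀ X : 𝒞, F.fib (F.ptIsTerminal.from X))
    (hweq : ∀ {X Y : 𝒞} (f : X ⟶ Y), F.weq f ↔ F.HomotopyEquiv f)
    {P X Y Z : 𝒞} {f : Z ⟶ X} {g : Z ⟶ Y} {inl : X ⟶ P} {inr : Y ⟶ P}
    (sq : IsPushout f g inl inr) (hg : F.Cofib g) (hf : F.fib f) (hf' : F.weq f) :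
    F.weq inr := by
  obtain ⟨W, j, q, hj, hq, hjq⟩ := F.factorization inr
  obtain ⟨s, hs⟩ := hcof X f hf hf'
  have := F.hasPullback q q hq
  have sqD := IsPullback.of_hasPullback q q
  obtain ⟨d, hd₁, hd₂⟩ := sqD.exists_lift (𝟙 W) (𝟙 W) rfl
  obtain ⟨V, w, π, hw, hπ, hwπ⟩ := F.factorization d
  have := F.hasPullback f f hf
  have sqZ := IsPullback.of_hasPullback f f
  obtain ⟨δ, hδ₁, hδ₂⟩ := sqZ.exists_lift (𝟙 Z) (𝟙 Z) rfl
  have hδ : F.weq δ := weq_of_section hδ₁ (F.trivFib_baseChange _ _ _ _ sqZ hf hf').2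
  have hgq : (g ≫ j) ≫ q = f ≫ inl := by rw [Category.assoc, hjq, sq.w]
  obtain ⟨b, hb₁, hb₂⟩ := sqD.exists_lift (pullback.fst f f ≫ g ≫ j) (pullback.snd f f ≫ g ≫ j)
    (by rw [Category.assoc, hgq, Category.assoc, hgq, ← Category.assoc, sqZ.w, Category.assoc])
  obtain ⟨H, hH⟩ := exists_lift_lower hcof (u := (g ≫ j) ≫ w) (b := b) hδ hπ (by
    rw [Category.assoc, hwπ]
    refine sqD.hom_ext ?_ ?_
    · rw [Category.assoc, hd₁, Category.comp_id, Category.assoc, hb₁, ← Category.assoc δ, hδ₁,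
        Category.id_comp]
    · rw [Category.assoc, hd₂, Category.comp_id, Category.assoc, hb₂, ← Category.assoc δ, hδ₂,
        Category.id_comp])
  obtain ⟨σ, hσ₁, hσ₂⟩ := sqZ.exists_lift (f ≫ s) (𝟙 Z)
    (by rw [Category.assoc, hs, Category.comp_id, Category.id_comp])
  have hfib₀ : F.fib (π ≫ pullback.fst q q) :=
    F.fib_comp _ _ hπ (F.fib_baseChange _ _ _ _ sqD hq)
  have hfib₁ : F.fib (π ≫ pullback.snd q q) :=
    F.fib_comp _ _ hπ (F.fib_baseChange _ _ _ _ sqD.flip hq)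
  have hw₀ : F.weq (π ≫ pullback.fst q q) :=
    weq_of_retraction (by rw [← Category.assoc, hwπ, hd₁]) hw
  have hw₁ : F.weq (π ≫ pullback.snd q q) :=
    weq_of_retraction (by rw [← Category.assoc, hwπ, hd₂]) hw
  obtain ⟨K, hgK, hK⟩ := hg _ hfib₁ hw₁ (σ ≫ H) j (by
    rw [Category.assoc, ← Category.assoc H, hH, hb₂, ← Category.assoc, hσ₂, Category.id_comp])
  obtain ⟨t, ht₁, ht₂⟩ := sq.exists_desc (s ≫ g ≫ j) (K ≫ π ≫ pullback.fst q q) (by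
    rw [← Category.assoc g K, hgK, Category.assoc, ← Category.assoc H, hH, hb₁,
      ← Category.assoc σ, hσ₁, Category.assoc])
  have htq : t ≫ q = 𝟙 P := by
    refine sq.hom_ext ?_ ?_
    · rw [← Category.assoc, ht₁, Category.assoc, hgq, ← Category.assoc, hs, Category.id_comp,
        Category.comp_id]
    · rw [← Category.assoc, ht₂, Category.comp_id, Category.assoc, Category.assoc, sqD.w,
        ← Category.assoc π, ← Category.assoc, hK, hjq]
  have hK' : F.weq K := F.weq_of_comp_right _ _ hw₁ (by rwa [hK])
  have hqt : F.weq (q ≫ t) := F.weq_of_comp_left j _ hj (by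
    rw [← Category.assoc, hjq, ht₂]
    exact F.weq_comp _ _ hK' hw₀)
  rw [← hjq]
  exact F.weq_comp _ _ hj (weq_of_weq_idempotent hfib hweq htq hqt)

/-- Every weak equivalence factors as a section of a trivial fibration followed by a trivial
fibration. -/
theorem exists_factorization_section (hfib : ∀ X : 𝒞, F.fib (F.ptIsTerminal.from X)) {Z X : 𝒞}
    {f : Z ⟶ X} (hf : F.weq f) :
    ∃ (W : 𝒞) (j : Z ⟶ W) (ρ : W ⟶ Z) (q : W ⟶ X), j ≫ ρ = 𝟙 Z ∧ j ≫ q = f ∧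
      F.fib ρ ∧ F.weq ρ ∧ F.fib q ∧ F.weq q := by
  obtain ⟨Q, π₁, π₂, ⟨hQ⟩, hπ₁, hπ₂⟩ := F.exists_product hfib Z X
  obtain ⟨k, hk₁, hk₂⟩ := exists_lift_of_isLimit_mk hQ (𝟙 Z) f
  obtain ⟨W, j, p, hj, hp, rfl⟩ := F.factorization k
  rw [Category.assoc] at hk₁ hk₂
  exact ⟨W, j, p ≫ π₁, p ≫ π₂, hk₁, hk₂, F.fib_comp _ _ hp hπ₁, weq_of_retraction hk₁ hj,
    F.fib_comp _ _ hp hπ₂, F.weq_of_comp_left j _ hj (by rwa [hk₂])⟩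

/-- The cobase extension of a weak equivalence along a cofibration is a weak equivalence. -/
theorem weq_cobaseChange (hcof : ∀ X : 𝒞, F.Cofibrant X)
    (hfib : ∀ X : 𝒞, F.fib (F.ptIsTerminal.from X))
    (hweq : ∀ {X Y : 𝒞} (f : X ⟶ Y), F.weq f ↔ F.HomotopyEquiv f)
    (hpush : ∀ {A X Y : 𝒞} (i : A ⟶ X) (f : A ⟶ Y), F.Cofib i → HasPushout i f)
    {P X Y Z : 𝒞} {f : Z ⟶ X} {g : Z ⟶ Y} {inl : X ⟶ P} {inr : Y ⟶ P}
    (sq : IsPushout f g inl inr) (hg : F.Cofib g) (hf : F.weq f) : F.weq inr := by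
  obtain ⟨W, j, ρ, q, hjρ, rfl, hρ, hρ', hq, hq'⟩ := exists_factorization_section hfib hf
  have := hpush g j hg
  have sq₁ : IsPushout j g (pushout.inr g j) (pushout.inl g j) :=
    (IsPushout.of_hasPushout g j).flip
  have hc : F.Cofib (pushout.inr g j) := Cofib.cobaseChange sq₁ hg
  obtain ⟨m, hm₁, hm₂⟩ := sq₁.exists_desc (q ≫ inl) inr (by rw [← Category.assoc, sq.w])
  have sq₂ : IsPushout q (pushout.inr g j) inl m :=
    IsPushout.of_left (by rwa [hm₂]) hm₁.symm sq₁
  obtain ⟨n, hn₁, hn₂⟩ := sq₁.exists_desc (ρ ≫ g) (𝟙 Y)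
    (by rw [← Category.assoc, hjρ, Category.id_comp, Category.comp_id])
  have sq₃ : IsPushout ρ (pushout.inr g j) g n :=
    IsPushout.of_left (by rw [hn₂, hjρ]; exact IsPushout.of_horiz_isIso ⟨by simp⟩) hn₁.symm sq₁
  rw [← hm₂]
  exact F.weq_comp _ _
    (weq_of_section hn₂ (weq_cobaseChange_of_trivFib hcof hfib hweq sq₃ hc hρ hρ'))
    (weq_cobaseChange_of_trivFib hcof hfib hweq sq₂ hc hq hq')

/-- The mapping cylinder factorization. -/
theorem exists_cylinder_factorization (F : BauesFibCat 𝒞) (hcof : ∀ X : 𝒞, F.Cofibrant X)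
    (hfib : ∀ X : 𝒞, F.fib (F.ptIsTerminal.from X))
    (hweq : ∀ {X Y : 𝒞} (f : X ⟶ Y), F.weq f ↔ F.HomotopyEquiv f)
    (hpush : ∀ {A X Y : 𝒞} (i : A ⟶ X) (f : A ⟶ Y), F.Cofib i → HasPushout i f)
    (hfold : ∀ X : 𝒞, ∃ (S : 𝒞) (in₁ in₂ : X ⟶ S) (fold : S ⟶ X),
      Nonempty (IsColimit (BinaryCofan.mk in₁ in₂)) ∧ in₁ ≫ fold = 𝟙 X ∧ in₂ ≫ fold = 𝟙 X ∧
      ∃ (Z : 𝒞) (j : S ⟶ Z) (w : Z ⟶ X), F.Cofib j ∧ F.weq w ∧ j ≫ w = fold)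
    {X Y : 𝒞} (f : X ⟶ Y) :
    ∃ (W : 𝒞) (i : X ⟶ W) (w : W ⟶ Y), F.Cofib i ∧ F.weq w ∧ i ≫ w = f := by
  obtain ⟨S, in₁, in₂, fold, ⟨hS⟩, hf₁, hf₂, Z, j, w, hj, hw, rfl⟩ := hfold X
  have hin₂ : F.Cofib in₂ := by
    intro E B p hp hp' a b h
    obtain ⟨l, hl⟩ := exists_lift_trivFib hcof hp hp' (in₁ ≫ b)
    obtain ⟨m, hm₁, hm₂⟩ := exists_desc_of_isColimit_mk hS l a
    refine ⟨m, hm₂, hom_ext_of_isColimit_mk hS ?_ ?_⟩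
    · rw [← Category.assoc, hm₁, hl]
    · rw [← Category.assoc, hm₂, h]
  have hc₂ : F.Cofib (in₂ ≫ j) := hin₂.comp hj
  have hc₂' : F.weq (in₂ ≫ j) := weq_of_section (by rw [Category.assoc, hf₂]) hw
  have := hpush (in₂ ≫ j) f hc₂
  have sq := IsPushout.of_hasPushout (in₂ ≫ j) f
  have hinr : F.weq (pushout.inr (in₂ ≫ j) f) :=
    LiftsFib.weq hfib hweq (LiftsFib.cobaseChange sq.flip (hc₂.liftsFib hc₂'))
  obtain ⟨r, hr₁, hr₂⟩ := sq.exists_desc (w ≫ f) (𝟙 Y)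
    (by rw [← Category.assoc, Category.assoc in₂, hf₂, Category.id_comp, Category.comp_id])
  refine ⟨_, in₁ ≫ j ≫ pushout.inl (in₂ ≫ j) f, r, ?_, weq_of_retraction hr₂ hinr, ?_⟩
  · intro E B p hp hp' a b h
    obtain ⟨l, hl⟩ := exists_lift_trivFib hcof hp hp' (pushout.inr (in₂ ≫ j) f ≫ b)
    obtain ⟨m, hm₁, hm₂⟩ := exists_desc_of_isColimit_mk hS a (f ≫ l)
    obtain ⟨n, hn, hn'⟩ := hj p hp hp' m (pushout.inl (in₂ ≫ j) f ≫ b) (by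
      refine hom_ext_of_isColimit_mk hS ?_ ?_
      · rw [← Category.assoc in₁ m, hm₁, ← h, Category.assoc, Category.assoc]
      · rw [← Category.assoc in₂ m, hm₂, Category.assoc, hl, ← Category.assoc,
          ← Category.assoc, sq.w, Category.assoc])
    obtain ⟨v, hv₁, hv₂⟩ := sq.exists_desc n l (by rw [Category.assoc, hn, hm₂])
    refine ⟨v, by rw [Category.assoc, Category.assoc, hv₁, hn, hm₁], sq.hom_ext ?_ ?_⟩
    · rw [← Category.assoc, hv₁, hn']
    · rw [← Category.assoc, hv₂, hl]
  · rw [Category.assoc, Category.assoc, hr₁, ← Category.assoc j, ← Category.assoc, hf₁,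
      Category.id_comp]

end BauesFibCat

/-- Theorem 6.8: a fibration category in which all objects are cofibrant and
`*`-fibrant, in which weak equivalences are exactly the homotopy equivalences, which has an
initial object, pushouts along cofibrations, and factorizations of fold maps into a
cofibration followed by a weak equivalence, is a cofibration category (with the same weak
equivalences and with the cofibrations), and all its objects are `∅`-cofibrant and fibrant. -/
theorem cofibrationCategory_of_fibrationCategory (F : BauesFibCat 𝒞)
    (hcof : ∀ X : 𝒞, F.Cofibrant X)
    (hfib : ∀ X : 𝒞, F.fib (F.ptIsTerminal.from X))
    (hweq : ∀ {X Y : 𝒞} (f : X ⟶ Y), F.weq f ↔ F.HomotopyEquiv f)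
    (O : 𝒞) (hO : IsInitial O)
    (hpush : ∀ {A X Y : 𝒞} (i : A ⟶ X) (f : A ⟶ Y), F.Cofib i → HasPushout i f)
    (hfold : ∀ X : 𝒞, ∃ (S : 𝒞) (in₁ in₂ : X ⟶ S) (fold : S ⟶ X),
      Nonempty (IsColimit (BinaryCofan.mk in₁ in₂)) ∧ in₁ ≫ fold = 𝟙 X ∧ in₂ ≫ fold = 𝟙 X ∧
      ∃ (Z : 𝒞) (j : S ⟶ Z) (w : Z ⟶ X), F.Cofib j ∧ F.weq w ∧ j ≫ w = fold) :
    -- C1: isomorphisms are trivial cofibrations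
    (∀ {X Y : 𝒞} (f : X ⟶ Y), IsIso f → F.Cofib f ∧ F.weq f) ∧
    -- C1: cofibrations compose
    (∀ {X Y Z : 𝒞} (f : X ⟶ Y) (g : Y ⟶ Z), F.Cofib f → F.Cofib g → F.Cofib (f ≫ g)) ∧
    -- C1: two-out-of-three for weak equivalences
    (∀ {X Y Z : 𝒞} (f : X ⟶ Y) (g : Y ⟶ Z), F.weq f → F.weq g → F.weq (f ≫ g)) ∧
    (∀ {X Y Z : 𝒞} (f : X ⟶ Y) (g : Y ⟶ Z), F.weq f → F.weq (f ≫ g) → F.weq g) ∧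
    (∀ {X Y Z : 𝒞} (f : X ⟶ Y) (g : Y ⟶ Z), F.weq g → F.weq (f ≫ g) → F.weq f) ∧
    -- C2: pushouts along cofibrations exist
    (∀ {A X Y : 𝒞} (i : A ⟶ X) (f : A ⟶ Y), F.Cofib i → HasPushout i f) ∧
    -- C2: cofibrations are stable under cobase change
    (∀ {P X Y Z : 𝒞} (f : Z ⟶ X) (g : Z ⟶ Y) (inl : X ⟶ P) (inr : Y ⟶ P),
      IsPushout f g inl inr → F.Cofib g → F.Cofib inl) ∧
    -- C2: trivial cofibrations are stable under cobase change
    (∀ {P X Y Z : 𝒞} (f : Z ⟶ X) (g : Z ⟶ Y) (inl : X ⟶ P) (inr : Y ⟶ P),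
      IsPushout f g inl inr → F.Cofib g → F.weq g → F.Cofib inl ∧ F.weq inl) ∧
    -- C2: the cobase extension of a weak equivalence along a cofibration is a weak equivalence
    (∀ {P X Y Z : 𝒞} (f : Z ⟶ X) (g : Z ⟶ Y) (inl : X ⟶ P) (inr : Y ⟶ P),
      IsPushout f g inl inr → F.Cofib g → F.weq f → F.weq inr) ∧
    -- C3: factorization into a cofibration followed by a weak equivalence
    (∀ {X Y : 𝒞} (f : X ⟶ Y), ∃ (W : 𝒞) (i : X ⟶ W) (w : W ⟶ Y),
      F.Cofib i ∧ F.weq w ∧ i ≫ w = f) ∧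
    -- C4: fibrant models
    (∀ X : 𝒞, ∃ (Y : 𝒞) (j : X ⟶ Y), F.Cofib j ∧ F.weq j ∧
      ∀ {Z : 𝒞} (k : Y ⟶ Z), F.Cofib k → F.weq k → ∃ r : Z ⟶ Y, k ≫ r = 𝟙 Y) ∧
    -- all objects are ∅-cofibrant
    (∀ X : 𝒞, F.Cofib (hO.to X)) ∧
    -- all objects are fibrant
    (∀ (X : 𝒞) {Z : 𝒞} (k : X ⟶ Z), F.Cofib k → F.weq k → ∃ r : Z ⟶ X, k ≫ r = 𝟙 X) := by
  have hO_cofib : ∀ X : 𝒞, F.Cofib (hO.to X) := by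
    intro X E B p hp hp' f g _
    obtain ⟨l, hl⟩ := BauesFibCat.exists_lift_trivFib hcof hp hp' g
    exact ⟨l, hO.hom_ext _ _, hl⟩
  have hfibrant : ∀ (X : 𝒞) {Z : 𝒞} (k : X ⟶ Z), F.Cofib k → F.weq k →
      ∃ r : Z ⟶ X, k ≫ r = 𝟙 X := by
    intro X Z k hk hk'
    obtain ⟨r, hr, -⟩ := hk.liftsFib hk' (F.ptIsTerminal.from X) (hfib X) (𝟙 X)
      (F.ptIsTerminal.from Z) (F.ptIsTerminal.hom_ext _ _)
    exact ⟨r, hr⟩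
  refine ⟨fun f _ => ⟨F.cofib_of_isIso f, (F.iso_trivFib f inferInstance).2⟩,
    fun f g hf hg => hf.comp hg, F.weq_comp, F.weq_of_comp_left, F.weq_of_comp_right, hpush,
    fun f g inl inr sq hg => BauesFibCat.Cofib.cobaseChange sq hg, fun f g inl inr sq hg hg' => ?_,
    fun f g inl inr sq hg hf => F.weq_cobaseChange hcof hfib hweq hpush sq hg hf,
    fun f => F.exists_cylinder_factorization hcof hfib hweq hpush hfold f,
    fun X => ⟨X, 𝟙 X, F.cofib_of_isIso _, F.weq_id X, hfibrant X⟩, hO_cofib, hfibrant⟩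
  exact ⟨BauesFibCat.Cofib.cobaseChange sq hg, BauesFibCat.LiftsFib.weq hfib hweq
    (BauesFibCat.LiftsFib.cobaseChange sq (hg.liftsFib hg'))⟩
end

section
/- Every dimap f : (X,≤) → (Y,≤) between pospaces admits a factorization f = p ∘ i where i is both a dicofibration and a dihomotopy equivalence and p is a difibration. -/
universe u v w

open scoped NNReal

/-- The Moore mapping path space of `f : X → Y`: a point `x`, a path `γ` in `Y` starting at `f x`,
and a length after which `γ` is constant. -/
def MoorePath {X Y : Type u} [TopologicalSpace Y] (f : X → Y) : Type u :=
  {w : X × C(ℝ≥0, Y) × ℝ≥0 // w.2.1 0 = f w.1 ∧ ∀ u, w.2.1 u = w.2.1 (min u w.2.2)}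

namespace MoorePath

variable {X Y : Type u} [TopologicalSpace Y] {f : X → Y}

/-- The base point of a Moore path. -/
def base (w : MoorePath f) : X := w.1.1

/-- The underlying map of a Moore path. -/
def path (w : MoorePath f) : C(ℝ≥0, Y) := w.1.2.1

/-- The length of a Moore path. -/
def length (w : MoorePath f) : ℝ≥0 := w.1.2.2

theorem ext {w w' : MoorePath f} (h₁ : w.base = w'.base) (h₂ : ∀ u, w.path u = w'.path u)
    (h₃ : w.length = w'.length) : w = w' :=
  Subtype.ext (Prod.ext h₁ (Prod.ext (ContinuousMap.ext h₂) h₃))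

theorem path_zero (w : MoorePath f) : w.path 0 = f w.base := w.2.1

theorem path_min (w : MoorePath f) (u : ℝ≥0) : w.path (min u w.length) = w.path u :=
  (w.2.2 u).symm

variable (f) in
/-- The Moore path of length zero at a point. -/
def const (x : X) : MoorePath f := ⟨(x, ContinuousMap.const _ (f x), 0), rfl, fun _ => rfl⟩

/-- The endpoint of a Moore path. -/
def endpoint (w : MoorePath f) : Y := w.path w.length

/-- The initial segment of length at most `s` of a Moore path. -/
def trunc (w : MoorePath f) (s : ℝ≥0) : MoorePath f :=
  ⟨(w.base, w.path.comp ⟨fun u => min u s, by fun_prop⟩, min s w.length), by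
    refine ⟨?_, fun u => ?_⟩
    · change w.path (min 0 s) = f w.base
      rw [min_eq_left zero_le, path_zero]
    · change w.path (min u s) = w.path (min (min u (min s w.length)) s)
      rw [← path_min w (min u s)]
      congr 1
      rw [min_assoc, min_assoc, min_right_comm s, min_self]⟩

theorem trunc_eq_self {w : MoorePath f} {s : ℝ≥0} (h : w.length ≤ s) : w.trunc s = w := by
  refine MoorePath.ext rfl (fun u => ?_) (min_eq_right h)
  change w.path (min u s) = w.path u
  rw [← path_min w (min u s), min_assoc, min_eq_right h, path_min]

theorem trunc_zero (w : MoorePath f) : w.trunc 0 = const f w.base := by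
  refine MoorePath.ext rfl (fun u => ?_) (min_eq_left zero_le)
  change w.path (min u 0) = f w.base
  rw [min_eq_right zero_le, path_zero]

/-- The deformation of the Moore path space onto the constant paths, run backwards. -/
def deform (z : MoorePath f × unitInterval) : MoorePath f :=
  z.1.trunc (unitInterval.toNNReal z.2 * max 1 z.1.length)

theorem deform_zero (w : MoorePath f) : deform (w, 0) = const f w.base := by
  simp [deform, trunc_zero]

theorem deform_one (w : MoorePath f) : deform (w, 1) = w :=
  trunc_eq_self (by simp)

/-- The length of a Moore path, capped at one. -/
def height (w : MoorePath f) : unitInterval :=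
  ⟨(min 1 w.length : ℝ≥0), NNReal.coe_nonneg _, by exact_mod_cast min_le_left _ _⟩

theorem height_const (x : X) : (const f x).height = 0 :=
  Subtype.ext (by simp [height, length, const])

theorem deform_height (w : MoorePath f) : deform (w, w.height) = w :=
  trunc_eq_self (min_mul_max 1 w.length ▸ (one_mul w.length).ge)

/-- The path `w` followed by the path `h`. -/
noncomputable def concat (w : MoorePath f) (h : unitInterval → Y) (t : unitInterval) (u : ℝ≥0) :
    Y :=
  if u ≤ w.length then w.path u
  else h (min (Set.projIcc 0 1 zero_le_one ((u - w.length : ℝ≥0) : ℝ)) t)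

theorem concat_zero (w : MoorePath f) (h : unitInterval → Y) (t : unitInterval) :
    w.concat h t 0 = f w.base := by
  rw [concat, if_pos zero_le, path_zero]

theorem concat_of_le {w : MoorePath f} {h : unitInterval → Y} (h0 : h 0 = w.endpoint)
    {t : unitInterval} {u : ℝ≥0} (hu : w.length + unitInterval.toNNReal t ≤ u) :
    w.concat h t u = h t := by
  unfold concat
  split_ifs with hul
  · have ht : unitInterval.toNNReal t = 0 := by
      simpa using hu.trans hul
    have ht' : t = 0 := Subtype.ext (congrArg NNReal.toReal ht)
    have hu' : u = w.length := hul.antisymm (le_self_add.trans hu)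
    rw [ht', hu', h0, endpoint]
  · congr 1
    apply min_eq_right
    rw [← Set.projIcc_val zero_le_one t]
    apply Set.monotone_projIcc
    exact_mod_cast (le_tsub_of_add_le_left hu : unitInterval.toNNReal t ≤ u - w.length)

theorem concat_min {w : MoorePath f} {h : unitInterval → Y} (h0 : h 0 = w.endpoint)
    (t : unitInterval) (u : ℝ≥0) :
    w.concat h t u = w.concat h t (min u (w.length + unitInterval.toNNReal t)) := by
  rcases le_total u (w.length + unitInterval.toNNReal t) with hu | hu
  · rw [min_eq_left hu]
  · rw [min_eq_right hu, concat_of_le h0 hu, concat_of_le h0 le_rfl]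

section Order

variable [PartialOrder X] [PartialOrder Y]

/-- Moore paths of equal length are compared pointwise; paths of different lengths are
incomparable. -/
instance : PartialOrder (MoorePath f) where
  le w w' := w.base ≤ w'.base ∧ (∀ u, w.path u ≤ w'.path u) ∧ w.length = w'.length
  le_refl _ := ⟨le_rfl, fun _ => le_rfl, rfl⟩
  le_trans _ _ _ h h' :=
    ⟨h.1.trans h'.1, fun u => (h.2.1 u).trans (h'.2.1 u), h.2.2.trans h'.2.2⟩
  le_antisymm _ _ h h' :=
    MoorePath.ext (h.1.antisymm h'.1) (fun u => (h.2.1 u).antisymm (h'.2.1 u)) h.2.2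

theorem trunc_mono {w w' : MoorePath f} (h : w ≤ w') (s : ℝ≥0) : w.trunc s ≤ w'.trunc s :=
  ⟨h.1, fun _ => h.2.1 _, congrArg (min s) h.2.2⟩

theorem deform_mono (t : unitInterval) : Monotone fun w : MoorePath f => deform (w, t) := by
  intro w w' h
  change w.trunc _ ≤ w'.trunc _
  dsimp only
  rw [h.2.2]
  exact trunc_mono h _

theorem height_eq {w w' : MoorePath f} (h : w ≤ w') : w.height = w'.height :=
  Subtype.ext (by simp only [height, h.2.2])

theorem concat_mono {w w' : MoorePath f} (hw : w ≤ w') {h h' : unitInterval → Y}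
    (hh : ∀ s, h s ≤ h' s) (t : unitInterval) (u : ℝ≥0) :
    w.concat h t u ≤ w'.concat h' t u := by
  unfold concat
  rw [hw.2.2]
  split_ifs
  · exact hw.2.1 u
  · exact hh _

end Order

variable [TopologicalSpace X]

instance : TopologicalSpace (MoorePath f) := instTopologicalSpaceSubtype

theorem continuous_base : Continuous (base : MoorePath f → X) :=
  continuous_fst.comp continuous_subtype_val

theorem continuous_path : Continuous (path : MoorePath f → C(ℝ≥0, Y)) :=
  continuous_fst.comp (continuous_snd.comp continuous_subtype_val)

theorem continuous_length : Continuous (length : MoorePath f → ℝ≥0) :=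
  continuous_snd.comp (continuous_snd.comp continuous_subtype_val)

theorem continuous_path_apply {A : Type*} [TopologicalSpace A]
    {w : A → MoorePath f} {u : A → ℝ≥0} (hw : Continuous w) (hu : Continuous u) : Continuous fun a => (w a).path (u a) :=
  ContinuousEval.continuous_eval.comp ((continuous_path.comp hw).prodMk hu)

/-- A map into the Moore path space is continuous once its components are, the path component
being jointly continuous. -/
theorem continuous_of_components {A : Type*} [TopologicalSpace A] {w : A → MoorePath f}
    (h₁ : Continuous fun a => (w a).base) (h₂ : Continuous fun z : A × ℝ≥0 => (w z.1).path z.2)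
    (h₃ : Continuous fun a => (w a).length) : Continuous w :=
  Continuous.subtype_mk
    (h₁.prodMk ((ContinuousMap.continuous_of_continuous_uncurry _ h₂).prodMk h₃)) _

theorem continuous_trunc : Continuous fun z : MoorePath f × ℝ≥0 => z.1.trunc z.2 := by
  refine continuous_of_components
    (show Continuous fun z : MoorePath f × ℝ≥0 => z.1.base from
      continuous_base.comp continuous_fst) ?_
    (continuous_snd.min (continuous_length.comp continuous_fst))
  exact (continuous_path_apply (by fun_prop) (by fun_prop) :
    Continuous fun z : (MoorePath f × ℝ≥0) × ℝ≥0 => z.1.1.path (min z.2 z.1.2))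

theorem continuous_deform : Continuous (deform : MoorePath f × unitInterval → MoorePath f) :=
  continuous_trunc.comp (continuous_fst.prodMk
    ((unitInterval.toNNReal_continuous.comp continuous_snd).mul
      (continuous_const.max (continuous_length.comp continuous_fst))))

theorem continuous_height : Continuous (height : MoorePath f → unitInterval) :=
  Continuous.subtype_mk
    (NNReal.continuous_coe.comp (continuous_const.min continuous_length)) _

theorem continuous_concat {A : Type*} [TopologicalSpace A] {F : A → MoorePath f}
    {H : A × unitInterval → Y} (hF : Continuous F) (hH : Continuous H)
    (hFH : ∀ a, H (a, 0) = (F a).endpoint) :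
    Continuous fun z : (A × unitInterval) × ℝ≥0 =>
      (F z.1.1).concat (fun s => H (z.1.1, s)) z.1.2 z.2 := by
  have hl : Continuous fun z : (A × unitInterval) × ℝ≥0 => (F z.1.1).length :=
    continuous_length.comp (hF.comp (by fun_prop))
  refine Continuous.if_le (continuous_path_apply (hF.comp (by fun_prop)) continuous_snd) ?_
    continuous_snd hl fun z hz => ?_
  · refine hH.comp (Continuous.prodMk (by fun_prop) (Continuous.min ?_ (by fun_prop)))
    exact continuous_projIcc.comp (NNReal.continuous_coe.comp (continuous_snd.sub hl))
  · have h0 : (Set.projIcc (0 : ℝ) 1 zero_le_one 0 : unitInterval) = 0 := Set.projIcc_left _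
    have h1 : min (0 : unitInterval) z.1.2 = 0 := min_eq_left bot_le
    simp only [hz, tsub_self, NNReal.coe_zero, h0, h1, hFH, endpoint]

variable [PartialOrder X] [PartialOrder Y]

theorem isDimap_base : IsDimap (base : MoorePath f → X) :=
  ⟨continuous_base, fun _ _ h => h.1⟩

theorem isDimap_const (hf : IsDimap f) : IsDimap (const f) :=
  ⟨continuous_of_components continuous_id (hf.1.comp continuous_fst) continuous_const,
    fun _ _ h => ⟨h, fun _ => hf.2 h, rfl⟩⟩

theorem isDimap_endpoint : IsDimap (endpoint : MoorePath f → Y) := by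
  refine ⟨continuous_path_apply continuous_id continuous_length, fun w w' h => ?_⟩
  change w.path w.length ≤ w'.path w'.length
  rw [← h.2.2]
  exact h.2.1 _

theorem isDihEquiv_const (hf : IsDimap f) : IsDihEquiv (const f) :=
  ⟨isDimap_const hf, base, isDimap_base,
    ⟨Prod.fst, continuous_fst, fun _ _ _ h => h, fun _ => rfl, fun _ => rfl⟩,
    deform, continuous_deform, deform_mono, deform_zero, deform_one⟩

theorem isDicofib_const (hf : IsDimap f) : IsDicofib.{u, v, w} (const f) := by
  refine ⟨isDimap_const hf, fun E B _ _ _ _ p hp _ g k hg hk hgk => ?_⟩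
  obtain ⟨G, hGc, hGm, hG0, hGp⟩ := hp.2 (MoorePath f) (g ∘ base)
    ⟨hg.1.comp isDimap_base.1, hg.2.comp isDimap_base.2⟩ (k ∘ deform)
    (hk.1.comp continuous_deform) (fun t => hk.2.comp (deform_mono t))
    (fun w => by simp [deform_zero, hgk])
  refine ⟨fun w => G (w, w.height),
    ⟨hGc.comp (continuous_id.prodMk continuous_height), fun w w' h => ?_⟩, fun x => ?_, fun w => ?_⟩
  · dsimp only
    rw [height_eq h]
    exact hGm _ h
  · dsimp only
    rw [height_const, hG0]
    rfl
  · rw [hGp, Function.comp_apply, deform_height]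

theorem isDifibA_endpoint : IsDifibA.{u} (endpoint : MoorePath f → Y) := by
  refine ⟨isDimap_endpoint, fun A _ _ F hF H hHc hHm hH0 => ?_⟩
  have hc := continuous_concat hF.1 hHc hH0
  let G (z : A × unitInterval) : MoorePath f :=
    ⟨((F z.1).base,
      ⟨(F z.1).concat (fun s => H (z.1, s)) z.2, hc.comp (Continuous.prodMk_right z)⟩,
      (F z.1).length + unitInterval.toNNReal z.2),
      concat_zero (F z.1) (fun s => H (z.1, s)) z.2,
      concat_min (h := fun s => H (z.1, s)) (hH0 z.1) z.2⟩
  refine ⟨G, ?_, fun t a a' h => ?_, fun a => ?_, fun a t =>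
    concat_of_le (w := F a) (h := fun s => H (a, s)) (hH0 a) le_rfl⟩
  · have hFc : Continuous fun z : A × unitInterval => F z.1 := hF.1.comp continuous_fst
    exact continuous_of_components
      (show Continuous fun z : A × unitInterval => (F z.1).base from continuous_base.comp hFc) hc
      ((continuous_length.comp hFc).add
        (unitInterval.toNNReal_continuous.comp continuous_snd))
  · exact ⟨(hF.2 h).1, concat_mono (hF.2 h) (fun s => hHm s h) t,
      congrArg (· + unitInterval.toNNReal t) (hF.2 h).2.2⟩
  · have hl : (F a).length + unitInterval.toNNReal 0 = (F a).length := by simp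
    refine MoorePath.ext rfl (fun u => ?_) hl
    change (F a).concat (fun s => H (a, s)) 0 u = (F a).path u
    rw [concat_min (h := fun s => H (a, s)) (hH0 a), hl, concat, if_pos (min_le_right _ _), path_min]

end MoorePath

/-- Every dimap of pospaces factors as a dimap that is both a dicofibration
and a dihomotopy equivalence, followed by a difibration. -/
theorem factorization_trivialDicofib_difib {X Y : Type u}
    [TopologicalSpace X] [PartialOrder X] [TopologicalSpace Y] [PartialOrder Y]
    (f : X → Y) (hf : IsDimap f) :
    ∃ (W : Pospace.{u}) (i : X → W) (p : W → Y),
      IsDicofib.{u, v, w} i ∧ IsDihEquiv i ∧ IsDifibA.{u} p ∧ ∀ x, p (i x) = f x :=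
  ⟨⟨MoorePath f, inferInstance, inferInstance⟩, MoorePath.const f, MoorePath.endpoint,
    MoorePath.isDicofib_const hf, MoorePath.isDihEquiv_const hf, MoorePath.isDifibA_endpoint,
    fun _ => rfl⟩
end

section
/- Every dimap f : (X,≤) → (Y,≤) between pospaces admits a factorization f = p ∘ i where i is a dicofibration and p is both a difibration and a dihomotopy equivalence. -/
universe u v w

open unitInterval

/-- A dihomotopy: a continuous family of monotone maps indexed by the unit interval. -/
def IsDihomotopy {X Y : Type*} [TopologicalSpace X] [PartialOrder X]
    [TopologicalSpace Y] [PartialOrder Y] (H : X × I → Y) : Prop :=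
  Continuous H ∧ ∀ t, Monotone fun x => H (x, t)

namespace Dihomotopy

section Paths

variable {X Y Z : Type*}

/-- The reversed family of paths. -/
def rev (c : X × I → Y) : X × I → Y := fun z => c (z.1, σ z.2)

/-- Pointwise concatenation of two families of paths. -/
noncomputable def concat (c d : X × I → Y) : X × I → Y := fun z =>
  if (z.2 : ℝ) ≤ 1 / 2 then c (z.1, Set.projIcc 0 1 zero_le_one (2 * z.2 : ℝ))
  else d (z.1, Set.projIcc 0 1 zero_le_one (2 * z.2 - 1 : ℝ))

lemma concat_left (c d : X × I → Y) (x : X) {t s : I} (h : (s : ℝ) = 2 * t) :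
    concat c d (x, t) = c (x, s) := by
  have hs := s.2.2
  have ht : (t : ℝ) ≤ 1 / 2 := by linarith
  simp only [concat, if_pos ht, ← h, Set.projIcc_val]

lemma concat_right {c d : X × I → Y} (hcd : ∀ x, c (x, 1) = d (x, 0)) (x : X) {t s : I}
    (h : (s : ℝ) = 2 * t - 1) : concat c d (x, t) = d (x, s) := by
  have hs := s.2.1
  rcases hs.eq_or_lt with h0 | h0
  · have : s = 0 := Subtype.ext h0.symm
    rw [concat_left c d x (s := 1) (by simp; linarith), hcd, this]
  · have ht : ¬ (t : ℝ) ≤ 1 / 2 := by linarith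
    simp only [concat, if_neg ht, ← h, Set.projIcc_val]

lemma comp_concat (p : Y → Z) (c d : X × I → Y) (z : X × I) :
    p (concat c d z) = concat (fun z => p (c z)) (fun z => p (d z)) z := by
  simp only [concat]
  split_ifs <;> rfl

lemma concat_zero (c d : X × I → Y) (x : X) : concat c d (x, 0) = c (x, 0) :=
  concat_left c d x (by simp)

lemma concat_one {c d : X × I → Y} (hcd : ∀ x, c (x, 1) = d (x, 0)) (x : X) :
    concat c d (x, 1) = d (x, 1) :=
  concat_right hcd x (by simp; norm_num)

lemma rev_zero (c : X × I → Y) (x : X) : rev c (x, 0) = c (x, 1) := by simp [rev]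

lemma rev_one (c : X × I → Y) (x : X) : rev c (x, 1) = c (x, 0) := by simp [rev]

/-- Traversing a path backwards, then the three-fold concatenation, then the last piece
backwards only runs along the three-fold concatenation, up to a change of parameter. -/
lemma concat_detour {u h v : X × I → Y} (hu : ∀ x, u (x, 0) = h (x, 0))
    (hv : ∀ x, h (x, 1) = v (x, 0)) :
    ∃ α β : I → I, Continuous α ∧ Continuous β ∧ α 0 = β 0 ∧ α 1 = β 1 ∧
      (∀ x t, concat (concat u (concat (concat (rev u) h) v)) (rev v) (x, t) =
        concat (concat (rev u) h) v (x, α t)) ∧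
      ∀ x t, h (x, t) = concat (concat (rev u) h) v (x, β t) := by
  have h1 : ∀ x, rev u (x, 1) = h (x, 0) := fun x => by rw [rev_one, hu]
  have h2 : ∀ x, concat (rev u) h (x, 1) = v (x, 0) := fun x => by rw [concat_one h1, hv]
  have h3 : ∀ x, u (x, 1) = concat (concat (rev u) h) v (x, 0) := fun x => by
    rw [concat_zero, concat_zero, rev_zero]
  have h4 : ∀ x, concat u (concat (concat (rev u) h) v) (x, 1) = rev v (x, 0) := fun x => by
    rw [concat_one h3, concat_one h2, rev_zero]
  have key : ∀ t : I, max (1 / 4 - t : ℝ) (min (4 * t - 1) (3 / 2 - t)) ∈ I := fun t => by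
    have := t.2.1
    have := t.2.2
    constructor
    · rcases le_total (t : ℝ) (1 / 4) with h | h
      · exact le_max_of_le_left (by linarith)
      · exact le_max_of_le_right (le_min (by linarith) (by linarith))
    · refine max_le (by linarith) ?_
      rcases le_total (t : ℝ) (1 / 2) with h | h
      · exact min_le_of_left_le (by linarith)
      · exact min_le_of_right_le (by linarith)
  have key' : ∀ t : I, ((1 + t) / 4 : ℝ) ∈ I := fun t => by
    have := t.2.1
    have := t.2.2
    constructor <;> linarith
  refine ⟨fun t => ⟨_, key t⟩, fun t => ⟨_, key' t⟩, by fun_prop, by fun_prop, ?_, ?_, ?_, ?_⟩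
  · ext; norm_num
  · ext; norm_num
  · intro x t
    have t0 := t.2.1
    have t1 := t.2.2
    rcases le_total (t : ℝ) (1 / 2) with ht | ht
    · rw [concat_left _ _ x (s := ⟨2 * t, by linarith, by linarith⟩) rfl]
      rcases le_total (t : ℝ) (1 / 4) with ht' | ht'
      · rw [concat_left _ _ x (s := ⟨4 * t, by linarith, by linarith⟩) (by simp; ring)]
        have e : max (1 / 4 - t : ℝ) (min (4 * t - 1) (3 / 2 - t)) = 1 / 4 - t :=
          max_eq_left (min_le_of_left_le (by linarith))
        rw [concat_left _ _ x (s := ⟨1 / 2 - 2 * t, by linarith, by linarith⟩)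
            (by simp only [e]; ring),
          concat_left _ _ x (s := ⟨1 - 4 * t, by linarith, by linarith⟩) (by simp; ring)]
        exact congrArg (fun s => u (x, s)) (Subtype.ext (by simp))
      · rw [concat_right h3 x (s := ⟨4 * t - 1, by linarith, by linarith⟩) (by simp; ring)]
        have e : max (1 / 4 - t : ℝ) (min (4 * t - 1) (3 / 2 - t)) = 4 * t - 1 := by
          rw [min_eq_left (by linarith), max_eq_right (by linarith)]
        simp only [e]
    · rw [concat_right h4 x (s := ⟨2 * t - 1, by linarith, by linarith⟩) rfl]
      have e : max (1 / 4 - t : ℝ) (min (4 * t - 1) (3 / 2 - t)) = 3 / 2 - t := by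
        rw [min_eq_right (by linarith), max_eq_right (by linarith)]
      rw [concat_right h2 x (s := ⟨2 - 2 * t, by linarith, by linarith⟩)
            (by simp only [e]; ring)]
      exact congrArg (fun s => v (x, s)) (Subtype.ext (by simp; ring))
  · intro x t
    have t0 := t.2.1
    have t1 := t.2.2
    rw [concat_left _ _ x (s := ⟨(1 + t) / 2, by linarith, by linarith⟩) (by simp; ring),
      concat_right h1 x (s := t) (by simp; ring)]

variable [TopologicalSpace X] [PartialOrder X] [TopologicalSpace Y] [PartialOrder Y]

lemma isDihomotopy_rev {c : X × I → Y} (hc : IsDihomotopy c) : IsDihomotopy (rev c) :=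
  ⟨hc.1.comp (by fun_prop), fun t => hc.2 (σ t)⟩

lemma isDihomotopy_concat {c d : X × I → Y} (hc : IsDihomotopy c) (hd : IsDihomotopy d)
    (hcd : ∀ x, c (x, 1) = d (x, 0)) : IsDihomotopy (concat c d) := by
  refine ⟨?_, fun t => ?_⟩
  · refine Continuous.if_le (hc.1.comp ?_) (hd.1.comp ?_) (by fun_prop) (by fun_prop) ?_
    · exact continuous_fst.prodMk (continuous_projIcc.comp (by fun_prop))
    · exact continuous_fst.prodMk (continuous_projIcc.comp (by fun_prop))
    · rintro ⟨x, t⟩ ht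
      have ht' : (t : ℝ) = 1 / 2 := ht
      simp only [ht']
      norm_num
      exact hcd x
  · by_cases ht : (t : ℝ) ≤ 1 / 2
    · simpa only [concat, if_pos ht] using hc.2 _
    · simpa only [concat, if_neg ht] using hd.2 _

end Paths

section Lifting

variable {E : Type*} {B : Type*} [TopologicalSpace E] [PartialOrder E]
  [TopologicalSpace B] [PartialOrder B] {p : E → B}
  {X : Type u} [TopologicalSpace X] [PartialOrder X]

/-- Lifting a homotopy of families of paths. -/
lemma exists_lift_family (hp : IsDifibA.{u} p) {c : X × I → E} (hc : IsDihomotopy c)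
    {H : (X × I) × I → B} (hH : Continuous H) (hm : ∀ t s, Monotone fun x => H ((x, t), s))
    (h0 : ∀ z, H (z, 0) = p (c z)) :
    ∃ G : (X × I) × I → E, Continuous G ∧ (∀ t s, Monotone fun x => G ((x, t), s)) ∧
      (∀ z, G (z, 0) = c z) ∧ ∀ z s, p (G (z, s)) = H (z, s) := by
  let ord : PartialOrder (X × I) :=
    { le := fun a b => a.1 ≤ b.1 ∧ a.2 = b.2
      lt := fun a b => (a.1 ≤ b.1 ∧ a.2 = b.2) ∧ ¬(b.1 ≤ a.1 ∧ b.2 = a.2)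
      lt_iff_le_not_ge := fun _ _ => Iff.rfl
      le_refl := fun a => ⟨le_rfl, rfl⟩
      le_trans := fun a b c h h' => ⟨h.1.trans h'.1, h.2.trans h'.2⟩
      le_antisymm := fun a b h h' => Prod.ext (h.1.antisymm h'.1) h.2 }
  obtain ⟨G, hG, hGm, hG0, hGp⟩ := @hp.2 (X × I) _ ord c
    ⟨hc.1, by
      rintro ⟨x, t⟩ ⟨y, s⟩ ⟨h, h'⟩
      obtain rfl : t = s := h'
      exact hc.2 t h⟩ H hH
    (by
      rintro r ⟨x, t⟩ ⟨y, s⟩ ⟨h, h'⟩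
      obtain rfl : t = s := h'
      exact hm t r h) h0
  exact ⟨G, hG, fun t s x y h => hGm s (show ord.le (x, t) (y, t) from ⟨h, rfl⟩), hG0, hGp⟩

/-- A lift along one parametrization can be replaced by a lift along another parametrization
with the same end points. -/
lemma exists_lift_reparam (hp : IsDifibA.{u} p) {c : X × I → E} (hc : IsDihomotopy c)
    {l : X × I → B} (hl : IsDihomotopy l) {α β : I → I} (hα : Continuous α) (hβ : Continuous β)
    (h0 : α 0 = β 0) (h1 : α 1 = β 1) (hcl : ∀ x t, p (c (x, t)) = l (x, α t)) :
    ∃ d : X × I → E, IsDihomotopy d ∧ (∀ x, d (x, 0) = c (x, 0)) ∧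
      (∀ x, d (x, 1) = c (x, 1)) ∧ ∀ x t, p (d (x, t)) = l (x, β t) := by
  let ρ : I × I → I := fun z => Set.projIcc 0 1 zero_le_one
    (max (min (β z.1 : ℝ) (α z.1 + z.2)) (α z.1 - z.2))
  have hρ : Continuous ρ := continuous_projIcc.comp (by fun_prop)
  obtain ⟨G, hG, hGm, hG0, hGp⟩ := exists_lift_family hp hc
    (H := fun z => l (z.1.1, ρ (z.1.2, z.2))) (hl.1.comp (by fun_prop))
    (fun t s => hl.2 (ρ (t, s))) (by
      rintro ⟨x, t⟩
      rw [hcl]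
      simp [ρ])
  let φ : I → I := fun t => ⟨|(β t : ℝ) - α t|, abs_nonneg _,
    abs_le.2 ⟨by linarith [(β t).2.1, (α t).2.2], by linarith [(β t).2.2, (α t).2.1]⟩⟩
  have hφ : Continuous φ := by fun_prop
  have hφ0 : φ 0 = 0 := Subtype.ext (by simp [φ, h0])
  have hφ1 : φ 1 = 0 := Subtype.ext (by simp [φ, h1])
  refine ⟨fun z => G (z, φ z.2), ⟨hG.comp (by fun_prop), fun t => hGm t (φ t)⟩, fun x => ?_,
    fun x => ?_, fun x t => ?_⟩
  · simp only [hφ0, hG0]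
  · simp only [hφ1, hG0]
  · rw [hGp]
    have : ρ (t, φ t) = β t := by
      have e : max (min (β t : ℝ) (α t + |(β t : ℝ) - α t|)) (α t - |(β t : ℝ) - α t|) = β t := by
        rw [min_eq_left (by linarith [le_abs_self ((β t : ℝ) - α t)]),
          max_eq_left (by linarith [neg_abs_le ((β t : ℝ) - α t)])]
      simp only [ρ, φ, e, Set.projIcc_val]
    simp only [this]

/-- A dihomotopy in the base of a difibration which is a dihomotopy equivalence lifts to a
dihomotopy with prescribed ends. -/
lemma exists_lift_between (hp : IsDifibA.{u} p) (he : IsDihEquiv p) {h : X × I → B}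
    (hh : IsDihomotopy h) {a b : X → E} (ha : IsDimap a) (hb : IsDimap b)
    (hpa : ∀ x, p (a x) = h (x, 0)) (hpb : ∀ x, p (b x) = h (x, 1)) :
    ∃ c : X × I → E, IsDihomotopy c ∧ (∀ x, c (x, 0) = a x) ∧ (∀ x, c (x, 1) = b x) ∧
      ∀ z, p (c z) = h z := by
  obtain ⟨-, q, hq, ⟨K, hK, hKm, hK0, hK1⟩, N, hN, hNm, hN0, hN1⟩ := he
  simp only [Function.comp_apply, id_eq] at hK0 hK1 hN0 hN1
  have loop : ∀ {a : X → E}, IsDimap a → ∃ k : X × I → E, ∃ n : X × I → B,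
      IsDihomotopy k ∧ IsDihomotopy n ∧ (∀ x, k (x, 0) = a x) ∧
      (∀ x, k (x, 1) = q (p (a x))) ∧ ∀ x t, n (x, t) = N (p (a x), t) := fun {a} ha =>
    ⟨rev fun z => K (a z.1, z.2), fun z => N (p (a z.1), z.2),
      isDihomotopy_rev ⟨hK.comp ((ha.1.comp continuous_fst).prodMk continuous_snd),
        fun t => (hKm t).comp ha.2⟩,
      ⟨hN.comp (((hp.1.1.comp ha.1).comp continuous_fst).prodMk continuous_snd),
        fun t => (hNm t).comp (hp.1.2.comp ha.2)⟩,
      fun x => by rw [rev_zero, hK1], fun x => by rw [rev_one, hK0], fun _ _ => rfl⟩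
  have comp_p : ∀ {k : X × I → E}, IsDihomotopy k → IsDihomotopy fun z => p (k z) :=
    fun hk => ⟨hp.1.1.comp hk.1, fun t => hp.1.2.comp (hk.2 t)⟩
  obtain ⟨ka, na, hka, hna, hka0, hka1, hna'⟩ := loop ha
  obtain ⟨kb, nb, hkb, hnb, hkb0, hkb1, hnb'⟩ := loop hb
  have ea : ∀ x, p (ka (x, 1)) = na (x, 0) := fun x => by rw [hka1, hna', hN0]
  have eb : ∀ x, p (kb (x, 1)) = nb (x, 0) := fun x => by rw [hkb1, hnb', hN0]
  set u : X × I → B := concat (fun z => p (ka z)) na with hu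
  set v : X × I → B := concat (fun z => p (kb z)) nb with hv
  have hud : IsDihomotopy u := isDihomotopy_concat (comp_p hka) hna ea
  have hvd : IsDihomotopy v := isDihomotopy_concat (comp_p hkb) hnb eb
  have hu0 : ∀ x, u (x, 0) = h (x, 0) := fun x => by rw [hu, concat_zero, hka0, hpa]
  have hv0 : ∀ x, h (x, 1) = v (x, 0) := fun x => by rw [hv, concat_zero, hkb0, hpb]
  have hu1 : ∀ x, u (x, 1) = u (x, 0) := fun x => by
    rw [hu0, hu, concat_one ea, hna', hN1, hpa]
  have hv1 : ∀ x, v (x, 1) = v (x, 0) := fun x => by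
    rw [← hv0, hv, concat_one eb, hnb', hN1, hpb]
  obtain ⟨α, β, hα, hβ, hαβ0, hαβ1, hdet, hβh⟩ := concat_detour hu0 hv0
  set l : X × I → B := concat (concat (rev u) h) v with hl
  have j1 : ∀ x, rev u (x, 1) = h (x, 0) := fun x => by rw [rev_one, hu0]
  have j2 : ∀ x, concat (rev u) h (x, 1) = v (x, 0) := fun x => by rw [concat_one j1, hv0]
  have hld : IsDihomotopy l :=
    isDihomotopy_concat (isDihomotopy_concat (isDihomotopy_rev hud) hh j1) hvd j2
  have hl0 : ∀ x, l (x, 0) = p (a x) := fun x => by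
    rw [hl, concat_zero, concat_zero, rev_zero, hu1, hu0, hpa]
  have hl1 : ∀ x, l (x, 1) = p (b x) := fun x => by
    rw [hl, concat_one j2, hv1, ← hv0, hpb]
  obtain ⟨M, hM, hMm, hM0, hMp⟩ := exists_lift_family hp (c := fun z => q (l z))
    ⟨hq.1.comp hld.1, fun t => hq.2.comp (hld.2 t)⟩ (H := fun z => N (l z.1, z.2))
    (hN.comp ((hld.1.comp continuous_fst).prodMk continuous_snd))
    (fun t s => (hNm s).comp (hld.2 t)) (fun z => hN0 _)
  let ma : X × I → E := fun z => M ((z.1, 0), z.2)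
  let mb : X × I → E := fun z => M ((z.1, 1), z.2)
  let s : X × I → E := fun z => M (z, 1)
  have hma : IsDihomotopy ma := ⟨hM.comp (by fun_prop), fun t => hMm 0 t⟩
  have hmb : IsDihomotopy mb := ⟨hM.comp (by fun_prop), fun t => hMm 1 t⟩
  have hs : IsDihomotopy s := ⟨hM.comp (by fun_prop), fun t => hMm t 1⟩
  have pma : (fun z => p (ma z)) = na := funext fun z => by
    simp only [ma, hMp, hl0, ← hna']
  have pmb : (fun z => p (mb z)) = nb := funext fun z => by
    simp only [mb, hMp, hl1, ← hnb']
  have ps : (fun z => p (s z)) = l := funext fun z => by simp only [s, hMp, hN1]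
  have i1 : ∀ x, ka (x, 1) = ma (x, 0) := fun x => by simp only [ma, hM0, hl0, hka1]
  have i2 : ∀ x, kb (x, 1) = mb (x, 0) := fun x => by simp only [mb, hM0, hl1, hkb1]
  have i3 : ∀ x, concat ka ma (x, 1) = s (x, 0) := fun x => by rw [concat_one i1]
  have i4 : ∀ x, concat (concat ka ma) s (x, 1) = rev (concat kb mb) (x, 0) := fun x => by
    rw [concat_one i3, rev_zero, concat_one i2]
  obtain ⟨d, hd, hd0, hd1, hdl⟩ := exists_lift_reparam hp
    (isDihomotopy_concat (isDihomotopy_concat (isDihomotopy_concat hka hma i1) hs i3)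
      (isDihomotopy_rev (isDihomotopy_concat hkb hmb i2)) i4) hld hα hβ hαβ0 hαβ1
    (fun x t => by
      rw [← hdet, comp_concat p]
      have e1 : (fun z => p (concat ka ma z)) = u := by
        funext z; rw [comp_concat p, pma]
      have e2 : (fun z => p (rev (concat kb mb) z)) = rev v := by
        funext z; simp only [rev]; rw [comp_concat p, pmb]
      have e3 : (fun z => p (concat (concat ka ma) s z)) = concat u l := by
        funext z; rw [comp_concat p, e1, ps]
      rw [e2, e3])
  refine ⟨d, hd, fun x => ?_, fun x => ?_, fun z => ?_⟩
  · rw [hd0, concat_zero, concat_zero, concat_zero, hka0]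
  · rw [hd1, concat_one i4, rev_one, concat_zero, hkb0]
  · rw [hdl z.1 z.2, ← hβh]

/-- Dimaps into the base of a difibration which is a dihomotopy equivalence lift. -/
lemma exists_lift_dimap (hp : IsDifibA.{u} p) (he : IsDihEquiv p) {g : X → B}
    (hg : IsDimap g) : ∃ s : X → E, IsDimap s ∧ ∀ x, p (s x) = g x := by
  obtain ⟨-, q, hq, -, N, hN, hNm, hN0, hN1⟩ := he
  obtain ⟨G, hG, hGm, -, hGp⟩ := hp.2 X (fun x => q (g x)) ⟨hq.1.comp hg.1, hq.2.comp hg.2⟩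
    (fun z => N (g z.1, z.2)) (hN.comp ((hg.1.comp continuous_fst).prodMk continuous_snd))
    (fun t => (hNm t).comp hg.2) (fun x => hN0 _)
  exact ⟨fun x => G (x, 1), ⟨hG.comp (by fun_prop), hGm 1⟩, fun x => by rw [hGp, hN1]; rfl⟩

/-- A subspace onto which the ambient space deforms, the deformation being complete at a time
that vanishes on the subspace, has the left lifting property with respect to difibrations. -/
lemma exists_lift_of_deformation (hp : IsDifibA.{u} p) {A : Type*} {j : A → X} {r : X → A}
    [TopologicalSpace A] [PartialOrder A] (hr : IsDimap r) (hrj : ∀ a, r (j a) = a)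
    {φ : X → I} (hφ : Continuous φ) (hφm : ∀ x y, x ≤ y → φ x = φ y) (hφj : ∀ a, φ (j a) = 0)
    {D : X × I → X} (hD : IsDihomotopy D) (hD0 : ∀ x, D (x, 0) = j (r x))
    (hDφ : ∀ x, D (x, φ x) = x) {f : A → E} {g : X → B} (hf : IsDimap f) (hg : IsDimap g)
    (hfg : ∀ a, p (f a) = g (j a)) :
    ∃ s : X → E, IsDimap s ∧ (∀ a, s (j a) = f a) ∧ ∀ x, p (s x) = g x := by
  obtain ⟨G, hG, hGm, hG0, hGp⟩ := hp.2 X (fun x => f (r x)) ⟨hf.1.comp hr.1, hf.2.comp hr.2⟩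
    (fun z => g (D z)) (hg.1.comp hD.1) (fun t => hg.2.comp (hD.2 t))
    (fun x => by rw [hD0, hfg])
  refine ⟨fun x => G (x, φ x), ⟨hG.comp (by fun_prop), fun x y h => ?_⟩, fun a => ?_,
    fun x => ?_⟩
  · simp only [hφm x y h]
    exact hGm _ h
  · simp only [hφj, hG0, hrj]
  · rw [hGp, hDφ]

end Lifting

end Dihomotopy

open Dihomotopy

/-- The mapping cylinder of a map, with the open cylinder and the base incomparable. -/
inductive MapCyl {X Y : Type u} (f : X → Y) : Type u
  | cyl (x : X) (t : I) (ht : t ≠ 1) : MapCyl f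
  | base (y : Y) : MapCyl f

namespace MapCyl

variable {X Y : Type u} {f : X → Y}

open Classical in
/-- The canonical map from the cylinder to the mapping cylinder. -/
noncomputable def mk (f : X → Y) (z : X × I) : MapCyl f :=
  if h : z.2 = 1 then base (f z.1) else cyl z.1 z.2 h

lemma mk_one (x : X) : mk f (x, 1) = base (f x) := by simp [mk]

lemma mk_of_ne (x : X) {t : I} (ht : t ≠ 1) : mk f (x, t) = cyl x t ht := by simp [mk, ht]

lemma induction_mk {P : MapCyl f → Prop} (h : ∀ z, P (mk f z)) (h' : ∀ y, P (base y)) (m) :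
    P m := by
  cases m with
  | cyl x t ht => exact mk_of_ne (f := f) x ht ▸ h (x, t)
  | base y => exact h' y

/-- The map out of the mapping cylinder given by a map on the cylinder and one on the base. -/
def desc {Z : Type*} (L : X × I → Z) (s : Y → Z) : MapCyl f → Z
  | cyl x t _ => L (x, t)
  | base y => s y

lemma desc_mk {Z : Type*} {L : X × I → Z} {s : Y → Z} (h : ∀ x, L (x, 1) = s (f x))
    (z : X × I) : desc L s (mk f z) = L z := by
  obtain ⟨x, t⟩ := z
  by_cases ht : t = 1
  · subst ht
    rw [mk_one, h]
    rfl
  · rw [mk_of_ne x ht]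
    rfl

noncomputable instance [TopologicalSpace X] [TopologicalSpace Y] : TopologicalSpace (MapCyl f) :=
  TopologicalSpace.coinduced (mk f) inferInstance ⊔ TopologicalSpace.coinduced base inferInstance

section Topology

variable [TopologicalSpace X] [TopologicalSpace Y]

lemma continuous_iff {Z : Type*} [TopologicalSpace Z] {g : MapCyl f → Z} :
    Continuous g ↔ Continuous (fun z => g (mk f z)) ∧ Continuous fun y => g (base y) := by
  exact continuous_sup_dom.trans (and_congr continuous_coinduced_dom continuous_coinduced_dom)

lemma continuous_mk : Continuous (mk f) := (continuous_iff.1 continuous_id).1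

lemma continuous_base : Continuous (base : Y → MapCyl f) := (continuous_iff.1 continuous_id).2

lemma continuous_of_prod {Z : Type*} [TopologicalSpace Z] {F : MapCyl f × I → Z}
    (h : Continuous fun z : (X × I) × I => F (mk f z.1, z.2))
    (h' : Continuous fun z : Y × I => F (base z.1, z.2)) : Continuous F := by
  have hc : ∀ m, Continuous fun s => F (m, s) :=
    induction_mk (fun z => h.comp (by fun_prop : Continuous fun s : I => (z, s)))
      (fun y => h'.comp (by fun_prop : Continuous fun s : I => (y, s)))
  let G : MapCyl f → C(I, Z) := fun m => ⟨fun s => F (m, s), hc m⟩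
  have hG : Continuous G := continuous_iff.2
    ⟨ContinuousMap.continuous_of_continuous_uncurry _ h,
      ContinuousMap.continuous_of_continuous_uncurry _ h'⟩
  exact (by fun_prop : Continuous fun z : MapCyl f × I => G z.1 z.2)

end Topology

section Order

variable [PartialOrder X] [PartialOrder Y]

instance : PartialOrder (MapCyl f) where
  le
    | cyl x t _, cyl x' t' _ => x ≤ x' ∧ t = t'
    | base y, base y' => y ≤ y'
    | _, _ => False
  le_refl m := by
    cases m with
    | cyl x t ht => exact ⟨le_rfl, rfl⟩
    | base y => exact le_refl y
  le_trans a b c h h' := by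
    cases a <;> cases b <;> cases c <;> first | exact h.elim | exact h'.elim | skip
    · exact ⟨h.1.trans h'.1, h.2.trans h'.2⟩
    · exact le_trans (α := Y) h h'
  le_antisymm a b h h' := by
    cases a <;> cases b <;> first | exact h.elim | skip
    · obtain ⟨h1, rfl⟩ := h
      obtain rfl := h1.antisymm h'.1
      rfl
    · exact congrArg base (le_antisymm (α := Y) h h')

lemma monotone_of {Z : Type*} [PartialOrder Z] {g : MapCyl f → Z}
    (h : ∀ t, Monotone fun x => g (mk f (x, t))) (h' : Monotone fun y => g (base y)) :
    Monotone g := by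
  intro a b hab
  cases a with
  | cyl x t ht =>
    cases b with
    | cyl x' t' ht' =>
      obtain ⟨hx, rfl⟩ := hab
      simpa only [mk_of_ne _ ht] using h t hx
    | base y => exact hab.elim
  | base y =>
    cases b with
    | cyl x' t' ht' => exact hab.elim
    | base y' => exact h' hab

lemma monotone_base : Monotone (base : Y → MapCyl f) := fun _ _ h => h

lemma monotone_mk (hf : Monotone f) (t : I) : Monotone fun x => mk f (x, t) := by
  intro x x' h
  by_cases ht : t = 1
  · subst ht
    simp only [mk_one]
    exact monotone_base (hf h)
  · simp only [mk_of_ne _ ht]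
    exact ⟨h, rfl⟩

end Order

/-- The projection of the mapping cylinder to the target. -/
def proj (f : X → Y) : MapCyl f → Y := desc (fun z => f z.1) id

lemma proj_mk (z : X × I) : proj f (mk f z) = f z.1 :=
  desc_mk (f := f) (L := fun z => f z.1) (s := id) (fun _ => rfl) z

lemma proj_base (y : Y) : proj f (base y) = y := rfl

/-- The deformation of the mapping cylinder to its base. -/
noncomputable def squash (f : X → Y) (z : MapCyl f × I) : MapCyl f :=
  desc (fun w => mk f (w.1, max w.2 z.2)) base z.1

lemma squash_mk (z : X × I) (s : I) : squash f (mk f z, s) = mk f (z.1, max z.2 s) :=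
  desc_mk (fun x => by rw [max_eq_left le_one', mk_one]) z

lemma squash_zero : ∀ m, squash f (m, 0) = m :=
  induction_mk (fun z => by rw [squash_mk, max_eq_left nonneg']) fun _ => rfl

lemma squash_one : ∀ m, squash f (m, 1) = base (proj f m) :=
  induction_mk (fun z => by rw [squash_mk, max_eq_right le_one', mk_one, proj_mk]) fun _ => rfl

lemma proj_squash (m : MapCyl f) (s : I) : proj f (squash f (m, s)) = proj f m :=
  induction_mk (P := fun m => proj f (squash f (m, s)) = proj f m)
    (fun z => by rw [squash_mk, proj_mk, proj_mk]) (fun _ => rfl) m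

variable [TopologicalSpace X] [PartialOrder X] [TopologicalSpace Y] [PartialOrder Y]

lemma isDimap_proj (hf : IsDimap f) : IsDimap (proj f) := by
  refine ⟨continuous_iff.2 ⟨?_, continuous_id⟩, monotone_of (fun t => ?_) monotone_id⟩
  · simp only [proj_mk]
    exact hf.1.comp continuous_fst
  · simp only [proj_mk]
    exact hf.2

lemma isDihomotopy_squash (hf : IsDimap f) : IsDihomotopy (squash f) := by
  refine ⟨continuous_of_prod ?_ ?_, fun s => monotone_of (fun t => ?_) monotone_base⟩
  · simp only [squash_mk]
    exact continuous_mk.comp (by fun_prop)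
  · exact continuous_base.comp continuous_fst
  · simp only [squash_mk]
    exact monotone_mk hf.2 _

/-- The inclusion of the free end of the mapping cylinder lifts against difibrations that are
dihomotopy equivalences. -/
lemma exists_lift (hf : IsDimap f) {E : Type*} {B : Type*} [TopologicalSpace E] [PartialOrder E]
    [TopologicalSpace B] [PartialOrder B] {p : E → B} (hp : IsDifibA.{u} p) (he : IsDihEquiv p)
    {a : X → E} {g : MapCyl f → B} (ha : IsDimap a) (hg : IsDimap g)
    (hag : ∀ x, p (a x) = g (mk f (x, 0))) :
    ∃ s : MapCyl f → E, IsDimap s ∧ (∀ x, s (mk f (x, 0)) = a x) ∧ ∀ m, p (s m) = g m := by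
  obtain ⟨b, hb, hpb⟩ := exists_lift_dimap hp he (g := fun y => g (base y))
    ⟨hg.1.comp continuous_base, hg.2.comp monotone_base⟩
  obtain ⟨c, hc, hc0, hc1, hpc⟩ := exists_lift_between hp he (h := fun z => g (mk f z))
    ⟨hg.1.comp continuous_mk, fun t => hg.2.comp (monotone_mk hf.2 t)⟩ ha
    (b := fun x => b (f x)) ⟨hb.1.comp hf.1, hb.2.comp hf.2⟩ hag
    (fun x => by rw [hpb, mk_one])
  have hd : ∀ z, desc c b (mk f z) = c z := desc_mk hc1
  refine ⟨desc c b, ⟨continuous_iff.2 ⟨?_, hb.1⟩, monotone_of (fun t => ?_) hb.2⟩, fun x => ?_,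
    induction_mk (fun z => ?_) hpb⟩
  · simpa only [hd] using hc.1
  · simpa only [hd] using hc.2 t
  · rw [hd, hc0]
  · rw [hd, hpc]

end MapCyl

/-- The space of paths of length at most one in the base, starting at the image of a point.
Comparable elements have paths of the same length. -/
structure PathFactor {M Y : Type u} [TopologicalSpace Y] (p : M → Y) : Type u where
  pt : M
  path : C(I, Y)
  len : I
  source : path 0 = p pt
  stable : ∀ s, len ≤ s → path s = path 1

namespace PathFactor

variable {M Y : Type u} [TopologicalSpace Y] {p : M → Y}

lemma ext' {z w : PathFactor p} (h1 : z.pt = w.pt) (h2 : ∀ s, z.path s = w.path s)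
    (h3 : z.len = w.len) : z = w := by
  cases z
  cases w
  obtain rfl : _ = _ := ContinuousMap.ext h2
  simp_all

/-- The end point of the path. -/
def target (z : PathFactor p) : Y := z.path 1

/-- The path of length zero at a point. -/
def const (p : M → Y) (m : M) : PathFactor p where
  pt := m
  path := ContinuousMap.const I (p m)
  len := 0
  source := rfl
  stable _ _ := rfl

/-- Cutting off the path at a given time. -/
def truncate (z : PathFactor p × I) : PathFactor p where
  pt := z.1.pt
  path := ⟨fun s => z.1.path (min s z.2), by fun_prop⟩
  len := min z.1.len z.2
  source := by
    change z.1.path (min 0 z.2) = _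
    rw [min_eq_left nonneg', z.1.source]
  stable s hs := by
    change z.1.path (min s z.2) = z.1.path (min 1 z.2)
    rw [min_eq_right (le_one' : z.2 ≤ 1)]
    rcases le_total z.2 s with h | h
    · rw [min_eq_right h]
    · rw [min_eq_left h]
      rcases min_le_iff.1 hs with h' | h'
      · rw [z.1.stable s h', z.1.stable z.2 (h'.trans h)]
      · rw [h.antisymm h']

lemma truncate_zero (z : PathFactor p) : truncate (z, 0) = const p z.pt :=
  ext' rfl (fun s => by
    change z.path (min s 0) = p z.pt
    rw [min_eq_right nonneg', z.source]) (min_eq_right nonneg')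

lemma truncate_len (z : PathFactor p) : truncate (z, z.len) = z :=
  ext' rfl (fun s => by
    change z.path (min s z.len) = z.path s
    rcases le_total s z.len with h | h
    · rw [min_eq_left h]
    · rw [min_eq_right h, z.stable s h, z.stable z.len le_rfl]) (min_self _)

/-- The path followed by an initial piece of a second path, traversed at unit speed unless the
total length exceeds one. -/
noncomputable def extendFun (z : PathFactor p) (h : I → Y) (t s : I) : Y :=
  if (s : ℝ) * max 1 (z.len + t : ℝ) ≤ z.len then
    z.path (Set.projIcc 0 1 zero_le_one (s * max 1 (z.len + t : ℝ)))
  else h (Set.projIcc 0 1 zero_le_one (min (s * max 1 (z.len + t : ℝ) - z.len) t))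

lemma extendFun_time_zero {z : PathFactor p} {h : I → Y} (h0 : h 0 = z.target) (s : I) :
    extendFun z h 0 s = z.path s := by
  have e : (s : ℝ) * max 1 (z.len + (0 : I) : ℝ) = s := by
    rw [max_eq_left (by simpa using z.len.2.2), mul_one]
  simp only [extendFun, e]
  split_ifs with hs
  · rw [Set.projIcc_val]
  · have hs' : (z.len : ℝ) ≤ s := (not_le.1 hs).le
    rw [min_eq_right (by simpa using hs'), z.stable s hs']
    exact (congrArg h (Set.projIcc_left (zero_le_one' ℝ))).trans h0

lemma extendFun_zero (z : PathFactor p) (h : I → Y) (t : I) : extendFun z h t 0 = p z.pt := by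
  have e : ((0 : I) : ℝ) * max 1 (z.len + t : ℝ) = 0 := by simp
  simp only [extendFun, e, if_pos z.len.2.1, ← z.source]
  exact congrArg z.path (Set.projIcc_left (zero_le_one' ℝ))

lemma extendFun_of_le {z : PathFactor p} {h : I → Y} (h0 : h 0 = z.target) {t s : I}
    (hs : min 1 (z.len + t : ℝ) ≤ s) : extendFun z h t s = h t := by
  have t0 := t.2.1
  have key : (z.len + t : ℝ) ≤ s * max 1 (z.len + t : ℝ) := by
    rcases le_total (1 : ℝ) (z.len + t) with h1 | h1
    · rw [max_eq_right h1]
      rw [min_eq_left h1] at hs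
      nlinarith
    · rw [max_eq_left h1]
      rw [min_eq_right h1] at hs
      linarith
  simp only [extendFun]
  split_ifs with h1
  · have e : (s : ℝ) * max 1 (z.len + t : ℝ) = z.len := le_antisymm h1 (by linarith)
    have ht : t = 0 := Subtype.ext (by
      change (t : ℝ) = 0
      linarith)
    rw [e, Set.projIcc_val, z.stable _ le_rfl, ht, h0]
    rfl
  · rw [min_eq_right (by linarith), Set.projIcc_val]

variable [TopologicalSpace M]

instance : TopologicalSpace (PathFactor p) :=
  TopologicalSpace.induced (fun z => (z.pt, z.path, z.len)) inferInstance

lemma continuous_data : Continuous fun z : PathFactor p => (z.pt, z.path, z.len) :=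
  continuous_induced_dom

lemma continuous_pt : Continuous (pt : PathFactor p → M) := continuous_data.fst

lemma continuous_path : Continuous (path : PathFactor p → C(I, Y)) := continuous_data.snd.fst

@[fun_prop]
lemma continuous_len : Continuous fun z : PathFactor p => z.len := continuous_data.snd.snd

lemma continuous_of {T : Type*} [TopologicalSpace T] {g : T → PathFactor p}
    (h1 : Continuous fun t => (g t).pt) (h2 : Continuous fun z : T × I => (g z.1).path z.2)
    (h3 : Continuous fun t => (g t).len) : Continuous g :=
  continuous_induced_rng.2
    (h1.prodMk ((ContinuousMap.continuous_of_continuous_uncurry _ h2).prodMk h3))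

lemma continuous_eval {T : Type*} [TopologicalSpace T] {g : T → PathFactor p} {s : T → I}
    (hg : Continuous g) (hs : Continuous s) : Continuous fun t => (g t).path (s t) := by
  have := continuous_path.comp hg
  exact (by fun_prop : Continuous fun t => (path ∘ g) t (s t))

lemma continuous_extendFun {T : Type*} [TopologicalSpace T] {z : T → PathFactor p}
    (hz : Continuous z) {H : T × I → Y} (hH : Continuous H)
    (h0 : ∀ x, H (x, 0) = (z x).target) :
    Continuous fun w : (T × I) × I => extendFun (z w.1.1) (fun t => H (w.1.1, t)) w.1.2 w.2 := by
  refine Continuous.if_le ?_ ?_ (by fun_prop) (by fun_prop) ?_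
  · exact continuous_eval (by fun_prop) (continuous_projIcc.comp (by fun_prop))
  · exact hH.comp (Continuous.prodMk (by fun_prop) (continuous_projIcc.comp (by fun_prop)))
  · rintro ⟨⟨x, t⟩, s⟩ h
    simp only at h ⊢
    rw [h, Set.projIcc_val, sub_self, min_eq_left t.2.1, Set.projIcc_left]
    exact ((z x).stable _ le_rfl).trans (h0 x).symm

variable [PartialOrder M] [PartialOrder Y]

instance : PartialOrder (PathFactor p) where
  le z w := z.pt ≤ w.pt ∧ (∀ s, z.path s ≤ w.path s) ∧ z.len = w.len
  le_refl z := ⟨le_rfl, fun _ => le_rfl, rfl⟩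
  le_trans a b c h h' :=
    ⟨h.1.trans h'.1, fun s => (h.2.1 s).trans (h'.2.1 s), h.2.2.trans h'.2.2⟩
  le_antisymm a b h h' :=
    ext' (h.1.antisymm h'.1) (fun s => (h.2.1 s).antisymm (h'.2.1 s)) h.2.2

lemma isDimap_target : IsDimap (target : PathFactor p → Y) :=
  ⟨continuous_eval continuous_id continuous_const, fun _ _ h => h.2.1 1⟩

lemma isDimap_pt : IsDimap (pt : PathFactor p → M) := ⟨continuous_pt, fun _ _ h => h.1⟩

lemma isDimap_const (hp : IsDimap p) : IsDimap (const p) :=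
  ⟨continuous_of continuous_id (hp.1.comp continuous_fst) continuous_const,
    fun _ _ h => ⟨h, fun _ => hp.2 h, rfl⟩⟩

lemma isDihomotopy_truncate : IsDihomotopy (truncate : PathFactor p × I → PathFactor p) := by
  refine ⟨continuous_of (g := truncate) ?_ ?_ ?_,
    fun t z w h => ⟨h.1, fun s => h.2.1 _, congrArg (fun l => min l t) h.2.2⟩⟩
  · exact (continuous_pt.comp continuous_fst : Continuous fun z : PathFactor p × I => z.1.pt)
  · exact continuous_eval (g := fun z : (PathFactor p × I) × I => z.1.1)
      (s := fun z => min z.2 z.1.2) (by fun_prop) (by fun_prop)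
  · exact (by fun_prop : Continuous fun z : PathFactor p × I => z.1.len).min continuous_snd

theorem isDifib_target : IsDifibA.{u} (target : PathFactor p → Y) := by
  refine ⟨isDimap_target, fun X _ _ f hf H hH hHm hH0 => ?_⟩
  have hfc := hf.1
  have hc := continuous_extendFun hf.1 hH hH0
  have hlen : ∀ z : X × I, min 1 ((f z.1).len + z.2 : ℝ) ∈ I := fun z =>
    ⟨le_min zero_le_one (add_nonneg (f z.1).len.2.1 z.2.2.1), min_le_left _ _⟩
  refine ⟨fun z =>
    { pt := (f z.1).pt
      path := ⟨fun s => extendFun (f z.1) (fun t => H (z.1, t)) z.2 s,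
        hc.comp (by fun_prop : Continuous fun s : I => (z, s))⟩
      len := ⟨_, hlen z⟩
      source := extendFun_zero (f z.1) (fun t => H (z.1, t)) z.2
      stable := fun s hs => (extendFun_of_le (h := fun t => H (z.1, t)) (hH0 z.1) hs).trans
        (extendFun_of_le (h := fun t => H (z.1, t)) (hH0 z.1) (min_le_left _ _)).symm },
    ?_, ?_, ?_, ?_⟩
  · refine continuous_of ?_ hc ?_
    · exact (continuous_pt.comp hf.1).comp continuous_fst
    · exact Continuous.subtype_mk (f := fun z : X × I => min 1 ((f z.1).len + z.2 : ℝ))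
        (by fun_prop) hlen
  · intro t x y hxy
    have h := hf.2 hxy
    refine ⟨h.1, fun s => ?_, ?_⟩
    · change extendFun (f x) (fun t => H (x, t)) t s ≤ extendFun (f y) (fun t => H (y, t)) t s
      simp only [extendFun, h.2.2]
      split_ifs
      · exact h.2.1 _
      · exact hHm _ hxy
    · ext
      simp [h.2.2]
  · intro x
    refine ext' rfl (extendFun_time_zero (h := fun t => H (x, t)) (hH0 x)) (Subtype.ext ?_)
    simpa using (f x).len.2.2
  · intro x t
    exact extendFun_of_le (h := fun t => H (x, t)) (hH0 x) (min_le_left _ _)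

/-- The length-zero paths lift against all difibrations. -/
lemma exists_lift {E : Type*} {B : Type*} [TopologicalSpace E] [PartialOrder E]
    [TopologicalSpace B] [PartialOrder B] {q : E → B} (hq : IsDifibA.{u} q)
    {f : M → E} {g : PathFactor p → B} (hf : IsDimap f) (hg : IsDimap g)
    (hfg : ∀ m, q (f m) = g (const p m)) :
    ∃ s : PathFactor p → E, IsDimap s ∧ (∀ m, s (const p m) = f m) ∧ ∀ z, q (s z) = g z :=
  exists_lift_of_deformation hq isDimap_pt (fun _ => rfl) continuous_len
    (fun _ _ h => h.2.2) (fun _ => rfl) isDihomotopy_truncate truncate_zero truncate_len hf hg hfg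

/-- Moving the point along a vertical deformation. -/
def movePt {D : M × I → M} (hD : ∀ m t, p (D (m, t)) = p m) (z : PathFactor p × I) :
    PathFactor p where
  pt := D (z.1.pt, z.2)
  path := z.1.path
  len := z.1.len
  source := by rw [hD, z.1.source]
  stable := z.1.stable

lemma isDihomotopy_movePt {D : M × I → M} (hD : ∀ m t, p (D (m, t)) = p m)
    (hd : IsDihomotopy D) : IsDihomotopy (movePt hD) :=
  ⟨continuous_of (hd.1.comp ((continuous_pt.comp (g := pt) continuous_fst).prodMk continuous_snd))
    (continuous_eval (g := fun z : (PathFactor p × I) × I => z.1.1) (by fun_prop) continuous_snd)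
    (by fun_prop : Continuous fun z : PathFactor p × I => z.1.len), fun t _ _ h => ⟨hd.2 t h.1, h.2⟩⟩

/-- Moving the starting point along the path, inside a section. -/
noncomputable def advance {s : Y → M} (hs : ∀ y, p (s y) = y) (z : PathFactor p × I) :
    PathFactor p where
  pt := s (z.1.path z.2)
  path := ⟨fun r => z.1.path (Set.projIcc 0 1 zero_le_one (r + z.2 : ℝ)),
    z.1.path.continuous.comp (continuous_projIcc.comp (by fun_prop))⟩
  len := Set.projIcc 0 1 zero_le_one (z.1.len - z.2 : ℝ)
  source := by
    rw [hs]
    simp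
  stable r hr := by
    have key : ∀ r : I, (z.1.len - z.2 : ℝ) ≤ r →
        z.1.path (Set.projIcc 0 1 zero_le_one (r + z.2 : ℝ)) = z.1.path 1 := fun r hr => by
      refine z.1.stable _ ?_
      rw [← Set.projIcc_val zero_le_one z.1.len]
      exact Set.monotone_projIcc _ (by linarith)
    have h1 : (z.1.len - z.2 : ℝ) ≤ 1 := by linarith [z.1.len.2.2, z.2.2.1]
    refine (key r (le_trans ?_ (show ((Set.projIcc 0 1 zero_le_one (z.1.len - z.2 : ℝ) : I) : ℝ)
      ≤ r from hr))).trans (key 1 (by simpa using h1)).symm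
    rw [Set.coe_projIcc, min_eq_right h1]
    exact le_max_right _ _

lemma isDihomotopy_advance {s : Y → M} (hs : ∀ y, p (s y) = y) (hd : IsDimap s) :
    IsDihomotopy (advance hs) := by
  refine ⟨continuous_of (g := advance hs)
    (hd.1.comp (continuous_eval continuous_fst continuous_snd)) ?_ ?_,
    fun t z w h => ⟨hd.2 (h.2.1 t), fun r => h.2.1 _, ?_⟩⟩
  · exact continuous_eval (g := fun z : (PathFactor p × I) × I => z.1.1)
      (s := fun z => Set.projIcc 0 1 zero_le_one (z.2 + z.1.2 : ℝ)) (by fun_prop)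
      (continuous_projIcc.comp (by fun_prop))
  · exact (continuous_projIcc (h := zero_le_one)).comp
      (by fun_prop : Continuous fun z : PathFactor p × I => (z.1.len - z.2 : ℝ))
  · simp only [advance, h.2.2]

/-- The target map is a dihomotopy equivalence as soon as the original map deforms vertically
onto the image of a section. -/
theorem isDihEquiv_target (hp : IsDimap p) {s : Y → M} (hs : IsDimap s)
    (hps : ∀ y, p (s y) = y) {D : M × I → M} (hd : IsDihomotopy D)
    (hD : ∀ m t, p (D (m, t)) = p m) (hD0 : ∀ m, D (m, 0) = m)
    (hD1 : ∀ m, D (m, 1) = s (p m)) : IsDihEquiv (target : PathFactor p → Y) := by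
  have hj : ∀ z : PathFactor p, movePt hD (z, 1) = advance hps (z, 0) := fun z =>
    ext' (by simp [movePt, advance, hD1, z.source]) (by simp [movePt, advance])
      (by simp [movePt, advance])
  obtain ⟨hc, hm⟩ := isDihomotopy_rev
    (isDihomotopy_concat (isDihomotopy_movePt hD hd) (isDihomotopy_advance hps hs) hj)
  refine ⟨isDimap_target, fun y => const p (s y),
    ⟨(isDimap_const hp).1.comp hs.1, (isDimap_const hp).2.comp hs.2⟩,
    ⟨_, hc, hm, fun z => ?_, fun z => ?_⟩,
    ⟨fun z => z.1, continuous_fst, fun _ => monotone_id, fun y => (hps y).symm, fun _ => rfl⟩⟩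
  · rw [rev_zero, concat_one hj]
    refine ext' rfl (fun r => ?_) ?_
    · change z.path (Set.projIcc 0 1 zero_le_one (r + (1 : I) : ℝ)) = p (s z.target)
      rw [hps, Set.projIcc_of_right_le _ (by simpa using r.2.1)]
      rfl
    · change Set.projIcc 0 1 zero_le_one (z.len - (1 : I) : ℝ) = 0
      rw [Set.projIcc_of_le_left _ (by simpa using z.len.2.2)]
      rfl
  · rw [rev_one, concat_zero]
    exact ext' (hD0 _) (fun _ => rfl) rfl

end PathFactor

/-- Every dimap of pospaces factors as a dicofibration followed by a dimap
that is both a difibration and a dihomotopy equivalence. -/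
theorem factorization_dicofib_trivialDifib {X Y : Type u}
    [TopologicalSpace X] [PartialOrder X] [TopologicalSpace Y] [PartialOrder Y]
    (f : X → Y) (hf : IsDimap f) :
    ∃ (W : Pospace.{u}) (i : X → W) (p : W → Y),
      IsDicofib.{u, v, w} i ∧ IsDifibA.{u} p ∧ IsDihEquiv p ∧ ∀ x, p (i x) = f x := by
  have hproj := MapCyl.isDimap_proj hf
  have hconst := PathFactor.isDimap_const hproj
  refine ⟨⟨PathFactor (MapCyl.proj f), inferInstance, inferInstance⟩,
    fun x => PathFactor.const (MapCyl.proj f) (MapCyl.mk f (x, 0)), PathFactor.target,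
    ⟨⟨?_, ?_⟩, ?_⟩, PathFactor.isDifib_target, ?_, fun x => MapCyl.proj_mk (x, 0)⟩
  · exact hconst.1.comp (MapCyl.continuous_mk.comp (by fun_prop))
  · exact hconst.2.comp (MapCyl.monotone_mk hf.2 0)
  · intro E B _ _ _ _ p hp he a g ha hg hag
    obtain ⟨s, hs, hs0, hsp⟩ := MapCyl.exists_lift hf hp he ha
      (g := fun m => g (PathFactor.const (MapCyl.proj f) m))
      ⟨hg.1.comp hconst.1, hg.2.comp hconst.2⟩ hag
    obtain ⟨r, hr, hr0, hrp⟩ := PathFactor.exists_lift hp hs hg hsp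
    exact ⟨r, hr, fun x => (hr0 _).trans (hs0 x), hrp⟩
  · exact PathFactor.isDihEquiv_target hproj ⟨MapCyl.continuous_base, MapCyl.monotone_base⟩
      MapCyl.proj_base (MapCyl.isDihomotopy_squash hf) MapCyl.proj_squash MapCyl.squash_zero
      MapCyl.squash_one
end
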